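/- arXiv:1510.05048 — 2 statements merged into one kernel-verified Lean document; each statement's English description precedes it below -/
import Mathlib

section
/- Let ℓ ≥ 1 be an integer, m = 2ℓ + 1, u = (3^m + 1)/2, and v = 2·3^ℓ + 1. There do not exist y₁, y₂ ∈ GF(3^m) with y₁ ≠ 0, y₂ ≠ 0, y₁ ≠ 1, y₂ ≠ 1, and y₁ ≠ y₂, such that y₁^u + y₂^u - 1 = 0 and y₁^v + y₂^v - 1 = 0. -/
theorem aux_plus {K : Type*} [Field K] (h3 : (3 : K) = 0) (σ : K →+* K)
    (hσ : ∀ x, σ (σ x) ^ 3 = x) (a b : K) (hab : a + b = 1)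
    (h : a * σ a ^ 2 + b * σ b ^ 2 = 1) : a = 0 ∨ a = 1 ∨ a = -1 := by
  obtain rfl : b = 1 - a := by linear_combination hab
  rw [map_sub, map_one] at h
  have e : (1 + σ a) * (σ a - a) = 0 := by
    linear_combination h + (-a * σ a + σ a) * h3
  rcases mul_eq_zero.1 e with e | e
  · right; right
    have h1 : σ a = -1 := by linear_combination e
    have h2 := hσ a
    rw [h1, map_neg, map_one] at h2
    rw [← h2]; norm_num
  · have h1 : σ a = a := by linear_combination e
    have h2 := hσ a
    rw [h1, h1] at h2
    have : a * ((a - 1) * (a + 1)) = 0 := by linear_combination h2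
    rcases mul_eq_zero.1 this with h | h
    · exact Or.inl h
    · rcases mul_eq_zero.1 h with h | h
      · right; left; linear_combination h
      · right; right; linear_combination h

theorem aux_cubic {K : Type*} [Field K] (h3 : (3 : K) = 0) (σ : K →+* K)
    (C D s : K) (hs : s ^ 2 = 1) (hD : D ≠ 0) (hc : σ (D ^ 3) = C)
    (e2 : C * D = D ^ 2 - 1) (e1 : D ^ 3 * C = C ^ 2 - 1)
    (g : D ^ 3 - s * D ^ 2 + D + s = 0) (hsσ : σ s = s) : False := by
  have g3 : (D ^ 3) ^ 3 - s * (D ^ 3) ^ 2 + D ^ 3 + s = 0 := by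
    have : (D ^ 3 - s * D ^ 2 + D + s) ^ 3 = 0 := by rw [g]; ring
    grind
  have gC : C ^ 3 - s * C ^ 2 + C + s = 0 := by
    have := congrArg σ g3
    simp only [map_add, map_sub, map_mul, map_zero, hsσ] at this
    rw [map_pow σ (D ^ 3), map_pow σ (D ^ 3), hc] at this
    exact this
  have gC' : D ^ 3 * (C ^ 3 + s * C ^ 2 + C - s) = 0 := by grind
  have gC2 : C ^ 3 + s * C ^ 2 + C - s = 0 := by
    rcases mul_eq_zero.1 gC' with h | h
    · exact absurd (pow_eq_zero_iff (by norm_num) |>.1 h) hD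
    · exact h
  have hC1 : C ^ 2 = 1 := by grind
  have : D ^ 3 * C = 0 := by rw [e1, hC1]; ring
  have hC : C = 0 := by
    rcases mul_eq_zero.1 this with h | h
    · exact absurd (pow_eq_zero_iff (by norm_num) |>.1 h) hD
    · exact h
  rw [hC] at hC1
  norm_num at hC1

theorem aux_minus {K : Type*} [Field K] (h3 : (3 : K) = 0) (σ : K →+* K)
    (hσ : ∀ x, σ (σ x) ^ 3 = x) (a b : K) (hab : a + b = 1)
    (h : a * σ a ^ 2 + b * σ b ^ 2 = -1) : False := by
  obtain rfl : b = 1 - a := by linear_combination hab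
  rw [map_sub, map_one] at h
  obtain ⟨c, hc⟩ : ∃ c, c = a + 1 := ⟨_, rfl⟩
  obtain rfl : a = c - 1 := by rw [hc]; ring
  rw [map_sub, map_one] at h
  have e1 : c * σ c = σ c ^ 2 - 1 := by grind
  have e2 : σ c * σ (σ c) = σ (σ c) ^ 2 - 1 := by
    have := congrArg σ e1
    simpa using this
  have hcD := hσ c
  generalize hD : σ (σ c) = D at *
  generalize hC : σ c = C at *
  subst hcD
  have hD0 : D ≠ 0 := by
    rintro rfl
    norm_num at e2
  have P : D ^ 6 + D ^ 4 - 1 = 0 := by grind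
  have F : (D ^ 3 - 1 * D ^ 2 + D + 1) * (D ^ 3 - (-1) * D ^ 2 + D + -1) = 0 := by grind
  rcases mul_eq_zero.1 F with g | g
  · exact aux_cubic h3 σ C D 1 (by norm_num) hD0 hC e2 e1 g (by simp)
  · exact aux_cubic h3 σ C D (-1) (by norm_num) hD0 hC e2 e1 g (by simp)

theorem aux_mixed {K : Type*} [Field K] (h3 : (3 : K) = 0) (σ : K →+* K)
    (hn : ∀ w : K, w ^ 2 ≠ -1)
    (hσ : ∀ x, σ (σ x) ^ 3 = x) (a b w z : K) (hab : a + b = 1)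
    (hw : a = w ^ 2) (hz : b = z ^ 2) (ha0 : a ≠ 0) (hb0 : b ≠ 0)
    (h : a * σ a ^ 2 - b * σ b ^ 2 = 1) : False := by
  obtain rfl : b = 1 - a := by linear_combination hab
  rw [map_sub, map_one] at h
  obtain ⟨t, ht⟩ : ∃ t, t = a + 1 := ⟨_, rfl⟩
  obtain rfl : a = t - 1 := by rw [ht]; ring
  rw [map_sub, map_one] at h
  have e1 : t * (σ t ^ 2 + 1) = σ t - 1 := by grind
  have e2 : σ t * (σ (σ t) ^ 2 + 1) = σ (σ t) - 1 := by
    have := congrArg σ e1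
    simpa using this
  have htS := hσ t
  generalize hS : σ (σ t) = S at *
  generalize hT : σ t = T at *
  subst htS
  -- if two elements p, -p are squares with p nonzero, contradiction
  have key : ∀ p x y : K, p ≠ 0 → p = x ^ 2 → -p = y ^ 2 → False := by
    intro p x y hp hx hy
    have hx0 : x ≠ 0 := by rintro rfl; apply hp; rw [hx]; ring
    apply hn (y / x)
    rw [div_pow, ← hx, ← hy, neg_div, div_self hp]
  have P : (S + 1) * ((S ^ 3 - S + 1) * (S ^ 3 - S ^ 2 - S - 1)) = 0 := by
    linear_combination (S ^ 2 + 1) ^ 2 * e1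
      - (S ^ 3 * (T * (S ^ 2 + 1) + (S - 1)) - (S ^ 2 + 1)) * e2
      + (-2 * S ^ 5 - S ^ 2 - 1) * h3
  rcases mul_eq_zero.1 P with g | g
  · apply hb0
    obtain rfl : S = -1 := by linear_combination g
    linear_combination h3
  rcases mul_eq_zero.1 g with g | g
  · have hS3 : S ^ 3 = S - 1 := by linear_combination g
    -- t = S - 1, a = t ^ 3, t + 1 = S
    have hp : S ≠ 0 := by
      rintro rfl
      norm_num at g
    have hm : S - 1 ≠ 0 := by
      rw [← hS3]; exact pow_ne_zero _ hp
    have hq : S ^ 3 - 1 = (S - 1) ^ 3 := by linear_combination (S ^ 2 - S) * h3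
    have s1 : S - 1 = (w / (S - 1)) ^ 2 := by
      rw [div_pow, ← hw, hq]; field_simp
    have s2 : S = ((w / (S - 1)) / S) ^ 2 := by
      rw [div_pow, ← s1, ← hS3]; field_simp
    refine key S _ z hp s2 ?_
    rw [← hz, hS3]; linear_combination (-1) * h3
  · have hp : S ≠ 0 := by
      rintro rfl
      norm_num at g
    have ha : S ^ 3 - 1 = S * (S + 1) := by linear_combination g
    have s1 : S = ((S - 1) / S) ^ 2 := by
      have : (S - 1) ^ 2 = S ^ 3 := by linear_combination (-1) * g - S * h3
      rw [div_pow, this]; field_simp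
    have hS1 : S - 1 ≠ 0 := by
      intro h
      apply hp
      rw [s1, h]; simp
    have hS2 : S + 1 ≠ 0 := by
      intro h
      apply ha0
      rw [ha, h, mul_zero]
    refine key (S + 1) (w * S / (S - 1)) (S ^ 2 - 1) hS2 ?_ ?_
    · have h5 : w ^ 2 = S * (S + 1) := by rw [← hw, ha]
      have h4 : (S - 1) ^ 2 = S ^ 3 := by linear_combination (-1) * g - S * h3
      rw [div_pow, mul_pow, h5, h4]; field_simp
    · grind

theorem stmt_13 (ℓ : ℕ) (hℓ : 1 ≤ ℓ) (m u v : ℕ)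
    (hm : m = 2 * ℓ + 1) (hu : u = (3 ^ m + 1) / 2) (hv : v = 2 * 3 ^ ℓ + 1) :
    ¬ ∃ y₁ y₂ : GaloisField 3 m, y₁ ≠ 0 ∧ y₂ ≠ 0 ∧ y₁ ≠ 1 ∧ y₂ ≠ 1 ∧ y₁ ≠ y₂ ∧
      y₁ ^ u + y₂ ^ u - 1 = 0 ∧ y₁ ^ v + y₂ ^ v - 1 = 0 := by
  rintro ⟨y₁, y₂, h10, h20, h11, h21, hne, hU, hV⟩
  have hm0 : m ≠ 0 := by omega
  have h3 : (3 : GaloisField 3 m) = 0 := by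
    exact_mod_cast CharP.cast_eq_zero (GaloisField 3 m) 3
  have : Fintype (GaloisField 3 m) := Fintype.ofFinite _
  have hcard : Fintype.card (GaloisField 3 m) = 3 ^ m := by
    rw [← Nat.card_eq_fintype_card, GaloisField.card 3 m hm0]
  have hfrob : ∀ x : GaloisField 3 m, x ^ (3 ^ m) = x := by
    intro x; rw [← hcard]; exact FiniteField.pow_card x
  obtain ⟨k, hk⟩ : ∃ k, 3 ^ m = 4 * k + 3 := by
    refine ⟨3 ^ m / 4, ?_⟩
    have : 3 ^ m % 4 = 3 := by
      rw [hm, pow_succ, pow_mul, Nat.mul_mod, Nat.pow_mod]; norm_num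
    omega
  have hu2 : u = 2 * (k + 1) := by omega
  have h20' : (2 : GaloisField 3 m) ≠ 0 := by
    intro h
    have : (1 : GaloisField 3 m) = 0 := by linear_combination h3 - h
    exact one_ne_zero this
  have hn : ∀ w : GaloisField 3 m, w ^ 2 ≠ -1 := by
    intro w hw
    have h := hfrob w
    have h4 : w ^ 4 = 1 := by linear_combination (w ^ 2 - 1) * hw
    rw [hk, pow_add, pow_mul, h4, one_pow, one_mul] at h
    have h2w : 2 * w = 0 := by linear_combination w * hw - h
    rcases mul_eq_zero.1 h2w with h | h
    · exact h20' h
    · rw [h] at hw; norm_num at hw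
  let σ : GaloisField 3 m →+* GaloisField 3 m := iterateFrobenius (GaloisField 3 m) 3 ℓ
  have hσd : ∀ x, σ x = x ^ 3 ^ ℓ := fun x => iterateFrobenius_def 3 ℓ x
  have hσ : ∀ x, σ (σ x) ^ 3 = x := by
    intro x
    rw [hσd, hσd, ← pow_mul, ← pow_mul]
    convert hfrob x using 2
    rw [hm]; ring
  have hvσ : ∀ x : GaloisField 3 m, x ^ v = x * σ x ^ 2 := by
    intro x; rw [hσd, hv]; ring
  have hsq : ∀ y : GaloisField 3 m, y ^ u = (y ^ (k + 1)) ^ 2 := by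
    intro y; rw [hu2]; ring
  have hpm : ∀ y : GaloisField 3 m, y ^ u = y ∨ y ^ u = -y := by
    intro y
    apply sq_eq_sq_iff_eq_or_eq_neg.1
    have : y ^ (3 ^ m + 1) = y ^ 2 := by rw [pow_succ, hfrob]; ring
    rw [← this, ← pow_mul]; congr 1; omega
  have s1 := hsq y₁
  have s2 := hsq y₂
  rw [hvσ, hvσ] at hV
  rcases hpm y₁ with e1 | e1 <;> rcases hpm y₂ with e2 | e2 <;>
    rw [e1, e2] at hU <;> rw [e1] at s1 <;> rw [e2] at s2
  · rcases aux_plus h3 σ hσ y₁ y₂ (by linear_combination hU) (by linear_combination hV)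
      with h | h | h
    · exact h10 h
    · exact h11 h
    · apply hne; linear_combination 2 * h - hU - h3
  · refine aux_mixed h3 σ hn hσ y₁ (-y₂) _ _ ?_ s1 s2 h10 (neg_ne_zero.2 h20) ?_
    · linear_combination hU
    · rw [map_neg]; linear_combination hV
  · refine aux_mixed h3 σ hn hσ y₂ (-y₁) _ _ ?_ s2 s1 h20 (neg_ne_zero.2 h10) ?_
    · linear_combination hU
    · rw [map_neg]; linear_combination hV
  · refine aux_minus h3 σ hσ (-y₁) (-y₂) ?_ ?_
    · linear_combination hU
    · rw [map_neg, map_neg]; linear_combination (-1) * hV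
end

section
/- Let ℓ ≥ 1 be an integer, m = 2ℓ + 1, u = (3^m + 1)/2, v = 2·3^ℓ + 1, and let π be a generator of GF(3^m)*. For a, b ∈ GF(3^m), define WT(a,b) = #{ i : 0 ≤ i ≤ 3^m - 2 and Tr(a·π^{-u·i} + b·π^{-v·i}) ≠ 0 }, where Tr is the trace from GF(3^m) to GF(3). If (a,b) ≠ (0,0), then WT(a,b) ∈ {2·3^{m-1}, 2·3^{m-1} + 2·3^ℓ, 2·3^{m-1} - 2·3^ℓ, 2·3^{m-1} + 3^ℓ, 2·3^{m-1} - 3^ℓ}. -/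
def pot17 : ℕ → ℕ → ℕ → ℤ
  | 1, 1, 0 => -3 | 1, 1, 1 => -2 | 1, 2, _ => -1
  | 2, 1, 0 => -4 | 2, 2, 0 => -1 | 2, 2, 1 => -2
  | 3, 1, 0 => -3 | 3, 2, 0 => -1 | 3, 2, 1 => -1
  | _, _, _ => 0

lemma pot17_step : ∀ a ∈ Finset.Icc 1 3, ∀ b ∈ Finset.Icc 1 3, ∀ n ∈ Finset.Icc 1 3,
    ∀ l ∈ Finset.range 3, ∀ l2 ∈ Finset.range 3, ∀ k ∈ Finset.range 3,
    3 * n = a + k + l + 2 * l2 → pot17 b n l2 ≤ pot17 a b l + (2 * (n:ℤ) - 2 * (l:ℤ) - 1) := by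
  decide

lemma sum_shift17 {M : Type*} [AddCommGroup M] (g : ℕ → M) (m : ℕ) (h : g m = g 0) :
    ∑ n ∈ Finset.range m, g (n + 1) = ∑ n ∈ Finset.range m, g n := by
  have h1 := Finset.sum_range_succ g m
  have h2 := Finset.sum_range_succ' g m
  rw [h1, h] at h2
  exact (add_right_cancel h2).symm

/-- cyclic rotations -/
lemma comb_core17 (m D : ℕ) (hm : m % 2 = 1) (hD : 0 < D) (X Y : ℕ → ℕ)
    (hX0 : ∀ n, 0 < X n) (hXD : ∀ n, X n < D) (hY0 : ∀ n, 0 < Y n) (hYD : ∀ n, Y n < D)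
    (hXm : ∀ n, X (n + m) = X n) (hYm : ∀ n, Y (n + m) = Y n)
    (hX3 : ∀ n, D ∣ 3 * X n - X (n + 2) ∧ X (n + 2) ≤ 3 * X n)
    (hY3 : ∀ n, D ∣ 3 * Y n - Y (n + 2) ∧ Y (n + 2) ≤ 3 * Y n)
    (hXY : ∀ n, D ∣ X (n + 1) + Y (n + 1) + 2 * Y n) :
    (m + 1) * D ≤ 2 * ∑ n ∈ Finset.range m, X n + 2 * ∑ n ∈ Finset.range m, Y n := by
  have hk : ∃ κ : ℕ → ℕ, ∀ n, 3 * X n = X (n + 2) + D * κ n := by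
    choose h h' using hX3
    choose κ hκ using h
    exact ⟨κ, fun n => by have := h' n; have := hκ n; omega⟩
  have hl : ∃ κ : ℕ → ℕ, ∀ n, 3 * Y n = Y (n + 2) + D * κ n := by
    choose h h' using hY3
    choose κ hκ using h
    exact ⟨κ, fun n => by have := h' n; have := hκ n; omega⟩
  obtain ⟨κ, hκ⟩ := hk
  obtain ⟨μ, hμ⟩ := hl
  choose M hM using hXY
  have hκ3 : ∀ n, κ n < 3 := fun n => by
    have h1 := hκ n; have h2 := hXD n
    by_contra h; push Not at h
    nlinarith [hX0 (n+2)]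
  have hμ3 : ∀ n, μ n < 3 := fun n => by
    have h1 := hμ n; have h2 := hYD n
    by_contra h; push Not at h
    nlinarith [hY0 (n+2)]
  have hM1 : ∀ n, 1 ≤ M n := fun n => by
    have h1 := hM n; have h2 := hY0 n
    by_contra h
    have : M n = 0 := by omega
    rw [this] at h1; omega
  have hM3 : ∀ n, M n ≤ 3 := fun n => by
    have h1 := hM n; have h2 := hYD n; have h3 := hXD (n+1); have h4 := hYD (n+1)
    by_contra h; push Not at h
    nlinarith
  have hrel : ∀ n, 3 * M n = M (n + 2) + κ (n + 1) + μ (n + 1) + 2 * μ n := fun n => by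
    apply Nat.eq_of_mul_eq_mul_left hD
    have h1 := hM n; have h2 := hM (n+2); have h3 := hκ (n+1); have h4 := hμ (n+1)
    have h5 := hμ n
    have e1 : n + 2 + 1 = n + 3 := rfl
    have e2 : n + 1 + 2 = n + 3 := rfl
    rw [e1] at h2; rw [e2] at h3 h4
    nlinarith
  have hper : ∀ {Z κ : ℕ → ℕ}, (∀ n, Z (n + m) = Z n) → (∀ n, 3 * Z n = Z (n + 2) + D * κ n) →
      ∀ n, κ (n + m) = κ n := by
    intro Z κ h1 h2 n
    apply Nat.eq_of_mul_eq_mul_left hD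
    have a := h2 n; have b := h2 (n + m)
    rw [show n + m + 2 = n + 2 + m by ring, h1, h1] at b
    omega
  have hκm := hper hXm hκ
  have hμm := hper hYm hμ
  have hMm : ∀ n, M (n + m) = M n := fun n => by
    apply Nat.eq_of_mul_eq_mul_left hD
    have a := hM n; have b := hM (n + m)
    rw [show n + m + 1 = n + 1 + m by ring, hXm, hYm, hYm] at b
    omega
  have sh : ∀ (f : ℕ → ℕ), (∀ n, f (n + m) = f n) →
      ∑ n ∈ Finset.range m, (f (n + 1) : ℤ) = ∑ n ∈ Finset.range m, (f n : ℤ) := by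
    intro f hf
    exact sum_shift17 (fun n => (f n : ℤ)) m (by simpa using hf 0)
  have sh2 : ∀ (f : ℕ → ℕ), (∀ n, f (n + m) = f n) →
      ∑ n ∈ Finset.range m, (f (n + 2) : ℤ) = ∑ n ∈ Finset.range m, (f n : ℤ) := by
    intro f hf
    rw [← sh f hf]
    exact sh (fun n => f (n + 1)) (fun n => by
      show f (n + m + 1) = f (n + 1)
      rw [show n + m + 1 = n + 1 + m by ring, hf])
  -- sums
  have s1 : (D : ℤ) * ∑ n ∈ Finset.range m, (κ n : ℤ) = 2 * ∑ n ∈ Finset.range m, (X n : ℤ) := by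
    have : ∑ n ∈ Finset.range m, (3 * X n : ℤ) =
        ∑ n ∈ Finset.range m, ((X (n+2) : ℤ) + D * κ n) :=
      Finset.sum_congr rfl fun n _ => by exact_mod_cast hκ n
    rw [Finset.sum_add_distrib, sh2 X hXm, ← Finset.mul_sum, ← Finset.mul_sum] at this
    linarith
  have s2 : (D : ℤ) * ∑ n ∈ Finset.range m, (μ n : ℤ) = 2 * ∑ n ∈ Finset.range m, (Y n : ℤ) := by
    have : ∑ n ∈ Finset.range m, (3 * Y n : ℤ) =
        ∑ n ∈ Finset.range m, ((Y (n+2) : ℤ) + D * μ n) :=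
      Finset.sum_congr rfl fun n _ => by exact_mod_cast hμ n
    rw [Finset.sum_add_distrib, sh2 Y hYm, ← Finset.mul_sum, ← Finset.mul_sum] at this
    linarith
  have s3 : 2 * ∑ n ∈ Finset.range m, (M n : ℤ) =
      ∑ n ∈ Finset.range m, (κ n : ℤ) + 3 * ∑ n ∈ Finset.range m, (μ n : ℤ) := by
    have : ∑ n ∈ Finset.range m, (3 * M n : ℤ) =
        ∑ n ∈ Finset.range m, ((M (n+2) : ℤ) + κ (n + 1) + μ (n + 1) + 2 * μ n) :=
      Finset.sum_congr rfl fun n _ => by exact_mod_cast hrel n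
    rw [Finset.sum_add_distrib, Finset.sum_add_distrib, Finset.sum_add_distrib, sh2 M hMm,
      sh κ hκm, sh μ hμm, ← Finset.mul_sum, ← Finset.mul_sum] at this
    linarith
  have s4 : 0 ≤ ∑ n ∈ Finset.range m, (2 * (M n : ℤ) - 2 * (μ (n + 1) : ℤ) - 1) := by
    have hg : ∑ n ∈ Finset.range m, pot17 (M (n + 1 + 1)) (M (n + 1)) (μ (n + 1)) =
        ∑ n ∈ Finset.range m, pot17 (M (n + 1)) (M n) (μ n) :=
      sum_shift17 (fun n => pot17 (M (n + 1)) (M n) (μ n)) m (by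
        have h1 := hMm 0; have h2 := hMm 1; have h3 := hμm 0
        simp only [zero_add] at h1 h3
        show pot17 (M (m + 1)) (M m) (μ m) = _
        rw [add_comm m 1, h2, h1, h3])
    have : ∑ n ∈ Finset.range m, pot17 (M (n + 1)) (M n) (μ n) ≤
        ∑ n ∈ Finset.range m, (pot17 (M (n + 1 + 1)) (M (n + 1)) (μ (n + 1)) +
          (2 * (M n : ℤ) - 2 * (μ (n + 1) : ℤ) - 1)) := by
      refine Finset.sum_le_sum fun n _ => ?_
      exact pot17_step _ (Finset.mem_Icc.2 ⟨hM1 _, hM3 _⟩) _ (Finset.mem_Icc.2 ⟨hM1 _, hM3 _⟩)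
        _ (Finset.mem_Icc.2 ⟨hM1 _, hM3 _⟩) _ (Finset.mem_range.2 (hμ3 _))
        _ (Finset.mem_range.2 (hμ3 _)) (κ (n + 1)) (Finset.mem_range.2 (hκ3 _)) (hrel n)
    rw [Finset.sum_add_distrib, hg] at this
    linarith
  rw [Finset.sum_sub_distrib, Finset.sum_sub_distrib, ← Finset.mul_sum, ← Finset.mul_sum,
    sh μ hμm] at s4
  simp only [Finset.sum_const, Finset.card_range, nsmul_eq_mul, mul_one] at s4
  have s5 : (m : ℤ) + 1 ≤ ∑ n ∈ Finset.range m, (κ n : ℤ) + ∑ n ∈ Finset.range m, (μ n : ℤ) := by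
    omega
  zify
  nlinarith [Int.natCast_pos.2 hD]

lemma digits_rot17 (m k : ℕ) (hk0 : 0 < k) (hk : k < 3 ^ m - 1) :
    (3 ^ m - 1) * (Nat.digits 3 k).sum = 2 * ∑ j ∈ Finset.range m, (3 ^ j * k % (3 ^ m - 1)) := by
  have hpos : 1 ≤ 3 ^ m := Nat.one_le_pow _ _ (by norm_num)
  obtain ⟨D, hD⟩ : ∃ D, 3 ^ m = D + 1 := ⟨3 ^ m - 1, by omega⟩
  have hD' : 3 ^ m - 1 = D := by omega
  rw [hD'] at hk ⊢
  have rot : ∀ j ∈ Finset.range m, 3 ^ j * k = 3 ^ j * k % D + D * (k / 3 ^ (m - j)) := by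
    intro j hj
    have hj := Finset.mem_range.1 hj
    have e : 3 ^ j * 3 ^ (m - j) = D + 1 := by rw [← pow_add, ← hD]; congr 1; omega
    have hdm := Nat.div_add_mod k (3 ^ (m - j))
    have hmod : k % 3 ^ (m - j) < 3 ^ (m - j) := Nat.mod_lt _ (by positivity)
    set A := k / 3 ^ (m - j) with hA
    set B := k % 3 ^ (m - j) with hB
    have hAlt : A < 3 ^ j := by
      rw [hA, Nat.div_lt_iff_lt_mul (by positivity), e]; omega
    have e2 : 3 ^ j * k = D * A + (A + 3 ^ j * B) := by
      rw [← hdm, mul_add, ← mul_assoc, e]; ring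
    have hle : A + 3 ^ j * B ≤ D := by
      have : 3 ^ j * B + 3 ^ j ≤ 3 ^ j * 3 ^ (m - j) := by
        rw [← Nat.mul_succ]; exact Nat.mul_le_mul_left _ hmod
      rw [e] at this; omega
    have hne : A + 3 ^ j * B ≠ D := by
      intro h
      have hd : D ∣ 3 ^ j * k := by rw [e2, h]; exact ⟨A + 1, by ring⟩
      have hc : Nat.Coprime D (3 ^ j) := by
        have : Nat.Coprime D (D + 1) := by simp
        rw [← e] at this
        exact Nat.Coprime.coprime_mul_right_right this
      have := Nat.le_of_dvd hk0 (hc.dvd_of_dvd_mul_left hd)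
      omega
    have : 3 ^ j * k % D = A + 3 ^ j * B := by
      rw [e2, Nat.mul_add_mod, Nat.mod_eq_of_lt (by omega)]
    rw [this, e2]; ring
  have leg := Nat.sub_one_mul_sum_log_div_pow_eq_sub_sum_digits (p := 3) k
  have hdig : (Nat.digits 3 k).sum ≤ k := Nat.digit_sum_le 3 k
  have hlog : ∑ i ∈ Finset.range (Nat.log 3 k).succ, k / 3 ^ i.succ =
      ∑ i ∈ Finset.range m, k / 3 ^ (i + 1) := by
    apply Finset.sum_subset
    · intro i hi
      have : Nat.log 3 k < m := Nat.log_lt_of_lt_pow (by omega) (by omega)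
      simp at hi ⊢; omega
    · intro i hi hi2
      simp only [Finset.mem_range, not_lt] at hi2
      exact Nat.div_eq_of_lt (Nat.lt_pow_of_log_lt (by norm_num) (by omega))
  have hrefl : ∑ j ∈ Finset.range m, k / 3 ^ (m - j) = ∑ i ∈ Finset.range m, k / 3 ^ (i + 1) := by
    rw [← Finset.sum_range_reflect]
    refine Finset.sum_congr rfl fun i hi => ?_
    have := Finset.mem_range.1 hi
    congr 2; omega
  have hs := Finset.sum_congr rfl rot
  rw [Finset.sum_add_distrib, ← Finset.sum_mul, ← Finset.mul_sum, hrefl] at hs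
  rw [hlog] at leg
  have hgeom : 2 * ∑ j ∈ Finset.range m, 3 ^ j = D := by
    have hg := geom_sum_mul (3 : ℤ) m
    zify
    have : (3:ℤ) ^ m = D + 1 := by exact_mod_cast hD
    linarith
  set SS := ∑ i ∈ Finset.range m, k / 3 ^ (i + 1)
  set G := ∑ j ∈ Finset.range m, 3 ^ j
  have e1 : (Nat.digits 3 k).sum + 2 * SS = k := by omega
  nlinarith

lemma comb17 (ℓ m : ℕ) (hm : m = 2 * ℓ + 1) (k l : ℕ) (hk0 : 0 < k) (hk : k < 3 ^ m - 1)
    (hl0 : 0 < l) (hl : l < 3 ^ m - 1) (h : 3 ^ m - 1 ∣ k + (2 * 3 ^ ℓ + 1) * l) :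
    m + 1 ≤ (Nat.digits 3 k).sum + (Nat.digits 3 l).sum := by
  have rk := digits_rot17 m k hk0 hk
  have rl := digits_rot17 m l hl0 hl
  have hpos : 1 ≤ 3 ^ m := Nat.one_le_pow _ _ (by norm_num)
  obtain ⟨D, hD⟩ : ∃ D, 3 ^ m = D + 1 := ⟨3 ^ m - 1, by omega⟩
  have hD' : 3 ^ m - 1 = D := by omega
  rw [hD'] at hk hl h rk rl
  have hDpos : 0 < D := by omega
  have hc3 : Nat.Coprime D 3 := by
    have : Nat.Coprime D (D + 1) := by simp
    rw [← hD, hm, pow_succ] at this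
    exact Nat.Coprime.coprime_mul_left_right this
  have hq1 : 3 ^ m ≡ 1 [MOD D] := by rw [hD]; simp [Nat.ModEq]
  have hper : ∀ j k, 3 ^ (j + m) * k % D = 3 ^ j * k % D := by
    intro j k
    have : 3 ^ (j + m) * k ≡ 3 ^ j * 1 * k [MOD D] := by
      rw [pow_add]; exact (hq1.mul_left _).mul_right _
    rw [mul_one] at this
    exact this
  have hperm : ∀ j t k, 3 ^ (j + m * t) * k % D = 3 ^ j * k % D := by
    intro j t k
    induction t with
    | zero => simp
    | succ t ih => rw [Nat.mul_succ, ← add_assoc, hper, ih]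
  have hpos' : ∀ k, 0 < k → k < D → ∀ j, 0 < 3 ^ j * k % D := by
    intro k h0 h1 j
    rw [Nat.pos_iff_ne_zero]
    intro h2
    have := (Nat.Coprime.pow_right j hc3).dvd_of_dvd_mul_left (Nat.dvd_of_mod_eq_zero h2)
    exact absurd (Nat.le_of_dvd h0 this) (by omega)
  have hperm2 : ∀ k, ∑ j ∈ Finset.range m, (3 ^ j * k % D) =
      ∑ n ∈ Finset.range m, (3 ^ ((ℓ + 1) * n) * k % D) := by
    intro k
    have hm0 : 0 < m := by omega
    refine Finset.sum_nbij' (fun j => 2 * j % m) (fun n => (ℓ + 1) * n % m) ?_ ?_ ?_ ?_ ?_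
    · intro j _; exact Finset.mem_range.2 (Nat.mod_lt _ hm0)
    · intro j _; exact Finset.mem_range.2 (Nat.mod_lt _ hm0)
    · intro j hj
      have hj := Finset.mem_range.1 hj
      show (ℓ + 1) * (2 * j % m) % m = j
      rw [Nat.mul_mod_mod, show (ℓ + 1) * (2 * j) = j + m * j by rw [hm]; ring,
        Nat.add_mul_mod_self_left, Nat.mod_eq_of_lt hj]
    · intro j hj
      have hj := Finset.mem_range.1 hj
      show 2 * ((ℓ + 1) * j % m) % m = j
      rw [Nat.mul_mod_mod, show 2 * ((ℓ + 1) * j) = j + m * j by rw [hm]; ring,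
        Nat.add_mul_mod_self_left, Nat.mod_eq_of_lt hj]
    · intro j hj
      show 3 ^ j * k % D = 3 ^ ((ℓ + 1) * (2 * j % m)) * k % D
      have e : (ℓ + 1) * (2 * j % m) + m * ((ℓ + 1) * (2 * j / m)) = j + m * j := by
        have := Nat.mod_add_div (2 * j) m
        calc _ = (ℓ + 1) * (2 * j % m + m * (2 * j / m)) := by ring
          _ = (ℓ + 1) * (2 * j) := by rw [this]
          _ = _ := by rw [hm]; ring
      rw [← hperm ((ℓ + 1) * (2 * j % m)) ((ℓ + 1) * (2 * j / m)) k, e, hperm]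
  have h3 : ∀ k n, D ∣ 3 * (3 ^ ((ℓ + 1) * n) * k % D) - 3 ^ ((ℓ + 1) * (n + 2)) * k % D ∧
      3 ^ ((ℓ + 1) * (n + 2)) * k % D ≤ 3 * (3 ^ ((ℓ + 1) * n) * k % D) := by
    intro k n
    have e : 3 ^ ((ℓ + 1) * (n + 2)) * k % D = 3 * (3 ^ ((ℓ + 1) * n) * k % D) % D := by
      rw [show (ℓ + 1) * (n + 2) = ((ℓ + 1) * n + 1) + m by rw [hm]; ring, hper, Nat.mul_mod_mod,
        pow_succ]
      congr 1; ring
    rw [e]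
    exact ⟨Nat.dvd_sub_mod _, Nat.mod_le _ _⟩
  have core := comb_core17 m D (by omega) hDpos
    (fun n => 3 ^ ((ℓ + 1) * n) * k % D) (fun n => 3 ^ ((ℓ + 1) * n) * l % D)
    (fun n => hpos' k hk0 hk _) (fun n => Nat.mod_lt _ hDpos)
    (fun n => hpos' l hl0 hl _) (fun n => Nat.mod_lt _ hDpos)
    (fun n => by
      show 3 ^ ((ℓ + 1) * (n + m)) * k % D = _
      rw [show (ℓ + 1) * (n + m) = (ℓ + 1) * n + m * (ℓ + 1) by ring, hperm])
    (fun n => by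
      show 3 ^ ((ℓ + 1) * (n + m)) * l % D = _
      rw [show (ℓ + 1) * (n + m) = (ℓ + 1) * n + m * (ℓ + 1) by ring, hperm])
    (h3 k) (h3 l) (fun n => by
      show D ∣ 3 ^ ((ℓ + 1) * (n + 1)) * k % D + 3 ^ ((ℓ + 1) * (n + 1)) * l % D
        + 2 * (3 ^ ((ℓ + 1) * n) * l % D)
      have e : 3 ^ ((ℓ + 1) * n) * l % D = 3 ^ ((ℓ + 1) * (n + 1) + ℓ) * l % D := by
        rw [show (ℓ + 1) * (n + 1) + ℓ = (ℓ + 1) * n + m by rw [hm]; ring, hper]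
      rw [e]
      have h4 : D ∣ 3 ^ ((ℓ + 1) * (n + 1)) * (k + (2 * 3 ^ ℓ + 1) * l) := Dvd.dvd.mul_left h _
      rw [← Nat.modEq_zero_iff_dvd] at h4 ⊢
      refine Nat.ModEq.trans ?_ h4
      rw [show 3 ^ ((ℓ + 1) * (n + 1)) * (k + (2 * 3 ^ ℓ + 1) * l) =
        3 ^ ((ℓ + 1) * (n + 1)) * k + 3 ^ ((ℓ + 1) * (n + 1)) * l +
          2 * (3 ^ ((ℓ + 1) * (n + 1) + ℓ) * l) by rw [pow_add]; ring]
      exact ((Nat.mod_modEq _ _).add (Nat.mod_modEq _ _)).add ((Nat.mod_modEq _ _).mul_left 2))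
  rw [← hperm2 k, ← hperm2 l, ← rk, ← rl, ← mul_add, mul_comm] at core
  exact Nat.le_of_mul_le_mul_left core hDpos

/-- Data used for the 3-adic Gauss sum computations. -/
structure Setup17 (F W R : Type*) [Field F] [Fintype F] [CommRing W] [CommRing R] where
  ι : W →+* R
  τ : F →* W
  res : W →+* F
  ω : R
  ψ : F → R
  τ0 : τ 0 = 0
  resτ : ∀ x, res (τ x) = x
  unit : ∀ w, res w ≠ 0 → IsUnit w
  hω : 1 + ω + ω ^ 2 = 0
  ψ0 : ψ 0 = 1
  ψadd : ∀ x y, ψ (x + y) = ψ x * ψ y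
  ψlam : ∀ x, ω - 1 ∣ ψ x - 1
  ψcube : ∀ x, ψ (x ^ 3) = ψ x
  ψsum : ∑ x, ψ x = 0

set_option linter.unusedSectionVars false
namespace Setup17
variable {F W R : Type*} [Field F] [Fintype F] [DecidableEq F] [CommRing W] [CommRing R]

/-- Teichmüller character on units -/
def T (s : Setup17 F W R) (x : Fˣ) : R := s.ι (s.τ (x : F))

/-- Gauss sums -/
def g (s : Setup17 F W R) (k : ℕ) : R := ∑ x : Fˣ, s.T x⁻¹ ^ k * s.ψ (x : F)

lemma T_mul (s : Setup17 F W R) (x y : Fˣ) : s.T (x * y) = s.T x * s.T y := by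
  simp [T]

lemma T_one (s : Setup17 F W R) : s.T 1 = 1 := by simp [T]

lemma T_pow (s : Setup17 F W R) (x : Fˣ) (n : ℕ) : s.T (x ^ n) = s.T x ^ n := by
  simp [T]

lemma T_sub_unit (s : Setup17 F W R) (x : Fˣ) (hx : x ≠ 1) : IsUnit (s.T x - 1) := by
  have : IsUnit (s.τ (x : F) - 1) := by
    apply s.unit
    rw [map_sub, map_one, s.resτ, sub_ne_zero]
    exact fun h => hx (Units.ext h)
  have h2 := this.map s.ι
  rwa [map_sub, map_one] at h2

lemma orth0 (s : Setup17 F W R) (x : Fˣ) (hx : x ≠ 1) :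
    ∑ k ∈ Finset.range (Fintype.card F - 1), s.T x ^ k = 0 := by
  have h := geom_sum_mul (s.T x) (Fintype.card F - 1)
  rw [← s.T_pow, ← Fintype.card_units, pow_card_eq_one, T_one, sub_self] at h
  rw [← Fintype.card_units]
  exact (s.T_sub_unit x hx).mul_left_eq_zero.1 h

lemma orth1 (s : Setup17 F W R) (k : ℕ) (hk : ¬ (Fintype.card F - 1) ∣ k) :
    ∑ x : Fˣ, s.T x ^ k = 0 := by
  obtain ⟨p, hp⟩ := IsCyclic.exists_generator (α := Fˣ)
  have hp1 : p ^ k ≠ 1 := by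
    intro h
    apply hk
    rw [← Fintype.card_units, ← Nat.card_eq_fintype_card, ← orderOf_eq_card_of_forall_mem_zpowers hp]
    exact orderOf_dvd_of_pow_eq_one h
  have h : s.T p ^ k * ∑ x : Fˣ, s.T x ^ k = ∑ x : Fˣ, s.T x ^ k := by
    rw [Finset.mul_sum]
    simp_rw [← mul_pow, ← s.T_mul]
    exact Fintype.sum_equiv (Equiv.mulLeft p) _ _ (fun x => rfl)
  have h2 : (s.T (p ^ k) - 1) * ∑ x : Fˣ, s.T x ^ k = 0 := by
    rw [s.T_pow, sub_mul, h, one_mul, sub_self]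
  exact (s.T_sub_unit _ hp1).mul_right_eq_zero.1 h2

lemma orth2 (s : Setup17 F W R) (k : ℕ) (hk : (Fintype.card F - 1) ∣ k) :
    ∑ x : Fˣ, s.T x ^ k = ((Fintype.card F - 1 : ℕ) : R) := by
  obtain ⟨c, rfl⟩ := hk
  have : ∀ x : Fˣ, s.T x ^ ((Fintype.card F - 1) * c) = 1 := fun x => by
    rw [pow_mul, ← s.T_pow, ← Fintype.card_units, pow_card_eq_one, T_one, one_pow]
  simp [this, Fintype.card_units]

lemma orth1' (s : Setup17 F W R) (k : ℕ) (hk : ¬ (Fintype.card F - 1) ∣ k) :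
    ∑ x : Fˣ, s.T x⁻¹ ^ k = 0 := by
  rw [← s.orth1 k hk]
  exact Fintype.sum_equiv (Equiv.inv Fˣ) _ _ (fun x => rfl)

lemma sum_units (f : F → R) : ∑ x : F, f x = f 0 + ∑ x : Fˣ, f (x : F) := by
  rw [← Fintype.sum_equiv (unitsEquivNeZero (G₀ := F)).symm (fun a : {a : F // a ≠ 0} => f a)
    (fun x : Fˣ => f x) (fun x => rfl)]
  rw [← Finset.add_sum_erase _ _ (Finset.mem_univ (0:F))]
  congr 1
  rw [Finset.sum_subtype]
  intro x; simp

lemma g_zero (s : Setup17 F W R) : s.g 0 = -1 := by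
  have h := sum_units s.ψ
  rw [s.ψsum, s.ψ0] at h
  simp only [g, pow_zero, one_mul]
  linear_combination -h

lemma inversion (s : Setup17 F W R) (x : Fˣ) :
    ∑ k ∈ Finset.range (Fintype.card F - 1), s.g k * s.T x ^ k
      = ((Fintype.card F - 1 : ℕ) : R) * s.ψ (x : F) := by
  simp only [g, Finset.sum_mul]
  rw [Finset.sum_comm]
  rw [Finset.sum_eq_single x]
  · have : ∀ k, s.T x⁻¹ ^ k * s.ψ (x : F) * s.T x ^ k = s.ψ (x : F) := fun k => by
      have : s.T x⁻¹ ^ k * s.T x ^ k = 1 := by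
        rw [← mul_pow, ← T_mul, inv_mul_cancel, T_one, one_pow]
      linear_combination (s.ψ (x : F)) * this
    simp [this]
  · intro y _ hy
    have : ∀ k, s.T y⁻¹ ^ k * s.ψ (y : F) * s.T x ^ k = s.ψ (y : F) * s.T (y⁻¹ * x) ^ k :=
      fun k => by rw [T_mul, mul_pow]; ring
    simp only [this]
    rw [← Finset.mul_sum, s.orth0, mul_zero]
    intro h
    exact hy (inv_mul_eq_one.1 h)
  · simp

/-- Jacobi-type sum -/
def J (s : Setup17 F W R) (n : ℕ) : W := ∑ t : F, s.τ ((1 + t) ^ (n + 1) * t⁻¹)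

lemma res_J (s : Setup17 F W R) (hq : 3 ≤ Fintype.card F) (n : ℕ) (hn : n < Fintype.card F - 1) :
    s.res (s.J n) = -((n : F) + 1) := by
  simp only [J, map_sum, s.resτ]
  have hF : ∀ f : F → F, ∑ x : F, f x = f 0 + ∑ x : Fˣ, f (x : F) := fun f => sum_units f
  induction n with
  | zero =>
    have h1 : ∑ t : F, ((1 + t) ^ (0 + 1) * t⁻¹) = ∑ t : F, t⁻¹ + ∑ t : F, t * t⁻¹ := by
      rw [← Finset.sum_add_distrib]; refine Finset.sum_congr rfl fun t _ => by ring
    have h2 : ∑ t : F, t⁻¹ = 0 := by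
      have : ∑ t : F, t⁻¹ = ∑ t : F, t ^ 1 :=
        Fintype.sum_equiv (inv_involutive (G := F)).toPerm _ _ (fun x => by simp)
      rw [this]
      exact FiniteField.sum_pow_lt_card_sub_one F 1 (by omega)
    have h3 : ∑ t : F, t * t⁻¹ = -1 := by
      rw [hF]
      simp only [zero_mul, zero_add, Units.ne_zero, ne_eq, not_false_eq_true, mul_inv_cancel₀]
      simp only [Finset.sum_const, Finset.card_univ, Fintype.card_units, nsmul_eq_mul, mul_one]
      rw [Nat.cast_sub (by omega)]; simp
    rw [h1, h2, h3]; simp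
  | succ n ih =>
    have ih := ih (by omega)
    have h1 : ∑ t : F, ((1 + t) ^ (n + 1 + 1) * t⁻¹) =
        ∑ t : F, ((1 + t) ^ (n + 1) * t⁻¹) + ∑ t : F, (1 + t) ^ (n + 1) * (t * t⁻¹) := by
      rw [← Finset.sum_add_distrib]; refine Finset.sum_congr rfl fun t _ => by ring
    have h2 : ∑ t : F, (1 + t) ^ (n + 1) * (t * t⁻¹) = -1 := by
      have a : ∑ t : F, (1 + t) ^ (n + 1) = 0 := by
        rw [← FiniteField.sum_pow_lt_card_sub_one F (n + 1) (by omega)]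
        exact Fintype.sum_equiv (Equiv.addLeft 1) _ _ (fun x => rfl)
      rw [hF] at a ⊢
      simp only [zero_mul, mul_zero, zero_add, Units.ne_zero, ne_eq, not_false_eq_true,
        mul_inv_cancel₀, mul_one]
      simp only [add_zero, one_pow] at a
      linear_combination a
    rw [h1, h2, ih]; push_cast; ring

lemma g_mul (s : Setup17 F W R) (n : ℕ) (hn : n + 1 < Fintype.card F - 1) :
    s.g n * s.g 1 = s.g (n + 1) * s.ι (s.J n) := by
  have hz : ¬ (Fintype.card F - 1) ∣ n + 1 := fun h => by
    have := Nat.le_of_dvd (by omega) h; omega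
  have e1 : s.g n * s.g 1 = ∑ t : Fˣ, ∑ x : Fˣ,
      s.T x⁻¹ ^ (n + 1) * s.T t⁻¹ * s.ψ ((x : F) * (1 + t)) := by
    simp only [g]
    rw [Finset.sum_mul_sum, Finset.sum_comm]
    rw [Finset.sum_comm]
    have : ∀ x : Fˣ, ∑ y : Fˣ, s.T x⁻¹ ^ n * s.ψ (x : F) * (s.T y⁻¹ ^ 1 * s.ψ (y : F)) =
        ∑ t : Fˣ, s.T x⁻¹ ^ (n + 1) * s.T t⁻¹ * s.ψ ((x : F) * (1 + t)) := by
      intro x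
      symm
      refine Fintype.sum_equiv (Equiv.mulLeft x) _ _ (fun t => ?_)
      simp only [Equiv.coe_mulLeft, mul_inv_rev, T_mul, Units.val_mul]
      rw [mul_add, mul_one, s.ψadd]; ring
    rw [Finset.sum_congr rfl fun x _ => this x, Finset.sum_comm]
  have e2 : s.ι (s.J n) = ∑ t : Fˣ, s.ι (s.τ ((1 + (t : F)) ^ (n + 1) * (t : F)⁻¹)) := by
    rw [J, map_sum, sum_units]; simp [s.τ0]
  rw [e1, e2, Finset.mul_sum]
  refine Finset.sum_congr rfl fun t _ => ?_
  by_cases ht : (1 : F) + t = 0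
  · simp only [ht, mul_zero, s.ψ0, mul_one, ne_eq, Nat.succ_ne_zero, not_false_eq_true, zero_pow,
      zero_mul, s.τ0, map_zero]
    rw [← Finset.sum_mul, s.orth1' _ hz, zero_mul]
  · obtain ⟨w, hw⟩ : ∃ w : Fˣ, (w : F) = 1 + t := ⟨Units.mk0 _ ht, rfl⟩
    rw [← hw]
    have e3 : s.ι (s.τ ((w : F) ^ (n + 1) * (t : F)⁻¹)) = s.T w ^ (n + 1) * s.T t⁻¹ := by
      simp [T]
    rw [e3, g, Finset.sum_mul]
    refine Fintype.sum_equiv (Equiv.mulRight w) _ _ (fun x => ?_)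
    simp only [Equiv.coe_mulRight, mul_inv_rev, T_mul, Units.val_mul]
    have : s.T w⁻¹ ^ (n + 1) * s.T w ^ (n + 1) = 1 := by
      rw [← mul_pow, ← T_mul, inv_mul_cancel, T_one, one_pow]
    linear_combination -(s.T x⁻¹ ^ (n + 1) * s.T t⁻¹ * s.ψ ((x : F) * w)) * this

lemma g_three (s : Setup17 F W R) [CharP F 3] (k : ℕ) : s.g (3 * k) = s.g k := by
  have hinj : Function.Injective (fun x : Fˣ => x ^ 3) := by
    intro x y h
    have h' : (x : F) ^ 3 = (y : F) ^ 3 := by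
      have := congrArg (fun z : Fˣ => (z : F)) h
      simpa using this
    have : Fact (Nat.Prime 3) := ⟨by norm_num⟩
    exact Units.ext (frobenius_inj F 3 h')
  have hb : Function.Bijective (fun x : Fˣ => x ^ 3) := Finite.injective_iff_bijective.1 hinj
  simp only [g]
  refine Fintype.sum_equiv (Equiv.ofBijective _ hb) _ _ (fun x => ?_)
  simp only [Equiv.ofBijective_apply, Units.val_pow_eq_pow_val, s.ψcube]
  rw [← inv_pow, T_pow, ← pow_mul]

lemma g_one (s : Setup17 F W R) (hq : 3 < Fintype.card F) : s.ω - 1 ∣ s.g 1 := by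
  have h := s.orth1' 1 (fun h => by have := Nat.le_of_dvd (by omega) h; omega)
  have : s.g 1 = ∑ x : Fˣ, s.T x⁻¹ ^ 1 * (s.ψ (x : F) - 1) := by
    simp only [mul_sub, mul_one, Finset.sum_sub_distrib, h, g, sub_zero]
  rw [this]
  exact Finset.dvd_sum fun x _ => (s.ψlam _).mul_left _

lemma g_val (s : Setup17 F W R) [CharP F 3] (hq : 3 < Fintype.card F) (k : ℕ)
    (hk : k < Fintype.card F - 1) : (s.ω - 1) ^ (Nat.digits 3 k).sum ∣ s.g k := by
  induction k using Nat.strong_induction_on with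
  | _ k ih =>
    rcases Nat.eq_zero_or_pos k with rfl | hk0
    · simp
    by_cases h3 : k % 3 = 0
    · obtain ⟨j, rfl⟩ := Nat.dvd_of_mod_eq_zero h3
      rw [Nat.digits_def' (by norm_num) hk0]
      simp only [Nat.mul_mod_right, List.sum_cons, zero_add]
      rw [Nat.mul_div_cancel_left _ (by norm_num), g_three]
      exact ih j (by omega) (by omega)
    · obtain ⟨n, rfl⟩ : ∃ n, k = n + 1 := ⟨k - 1, by omega⟩
      have hs : (Nat.digits 3 (n + 1)).sum = (Nat.digits 3 n).sum + 1 := by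
        rw [Nat.digits_def' (by norm_num) hk0]
        rcases Nat.eq_zero_or_pos n with rfl | hn0
        · simp
        rw [Nat.digits_def' (n := n) (by norm_num) hn0, List.sum_cons, List.sum_cons,
          show (n + 1) / 3 = n / 3 by omega]
        omega
      have hJ : IsUnit (s.ι (s.J n)) := by
        apply IsUnit.map
        apply s.unit
        rw [s.res_J hq.le n (by omega), neg_ne_zero]
        intro h0
        have : ((n + 1 : ℕ) : F) = 0 := by push_cast; exact h0
        rw [CharP.cast_eq_zero_iff F 3] at this
        omega
      have hm := s.g_mul n hk
      rw [hs, pow_succ, ← hJ.dvd_mul_right, ← hm]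
      exact mul_dvd_mul (ih n (by omega) (by omega)) (s.g_one hq)

lemma lam_three (s : Setup17 F W R) : (3 : R) = -s.ω ^ 2 * (s.ω - 1) ^ 2 := by
  have h := s.hω
  linear_combination (3 - 3 * s.ω + s.ω ^ 2 * (1 : R) - 0 * s.ω) * h

lemma S_val (s : Setup17 F W R) [CharP F 3] (ℓ m : ℕ) (hm : m = 2 * ℓ + 1) (hℓ : 1 ≤ ℓ)
    (hq : Fintype.card F = 3 ^ m)
    (hd : ∀ l, 3 ^ m - 1 ∣ (2 * 3 ^ ℓ + 1) * l → 3 ^ m - 1 ∣ l) (a b : Fˣ) :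
    (s.ω - 1) ^ (m + 1) ∣ ((3 ^ m - 1 : ℕ) : R) ^ 2 *
      ∑ x : F, s.ψ (a * x + b * x ^ (2 * 3 ^ ℓ + 1)) := by
  set d := 2 * 3 ^ ℓ + 1 with hdd
  set D := 3 ^ m - 1 with hD
  have h27 : 3 ^ 3 ≤ 3 ^ m := Nat.pow_le_pow_right (by norm_num) (by omega)
  have hq3 : 3 < Fintype.card F := by rw [hq]; omega
  have hinv : ∀ x : Fˣ, ∑ k ∈ Finset.range D, s.g k * s.T x ^ k = (D : R) * s.ψ (x : F) := by
    intro x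
    have := s.inversion x
    rwa [hq] at this
  have e1 : ∀ x : Fˣ, (D : R) ^ 2 * s.ψ ((a : F) * x + b * (x : F) ^ d) =
      ∑ k ∈ Finset.range D, ∑ l ∈ Finset.range D,
        (s.g k * s.g l * s.T a ^ k * s.T b ^ l) * s.T x ^ (k + d * l) := by
    intro x
    have h1 := hinv (a * x)
    have h2 := hinv (b * x ^ d)
    rw [s.ψadd]
    have : (D : R) ^ 2 * (s.ψ ((a : F) * x) * s.ψ (b * (x : F) ^ d)) =
      ((D : R) * s.ψ ((a * x : Fˣ) : F)) * ((D : R) * s.ψ ((b * x ^ d : Fˣ) : F)) := by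
      push_cast; ring
    rw [this, ← h1, ← h2, Finset.sum_mul_sum]
    refine Finset.sum_congr rfl fun k _ => Finset.sum_congr rfl fun l _ => ?_
    rw [T_mul, T_mul, T_pow]; ring
  have e2 : (D : R) ^ 2 * ∑ x : Fˣ, s.ψ ((a : F) * x + b * (x : F) ^ d) =
      ∑ k ∈ Finset.range D, ∑ l ∈ Finset.range D,
        (s.g k * s.g l * s.T a ^ k * s.T b ^ l) * ∑ x : Fˣ, s.T x ^ (k + d * l) := by
    rw [Finset.mul_sum, Finset.sum_congr rfl fun x _ => e1 x, Finset.sum_comm]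
    refine Finset.sum_congr rfl fun k _ => ?_
    rw [Finset.sum_comm]
    refine Finset.sum_congr rfl fun l _ => ?_
    rw [Finset.mul_sum]
  have hterm : ∀ k ∈ Finset.range D, ∀ l ∈ Finset.range D, ¬ (k = 0 ∧ l = 0) →
      (s.ω - 1) ^ (m + 1) ∣ (s.g k * s.g l * s.T a ^ k * s.T b ^ l) *
        ∑ x : Fˣ, s.T x ^ (k + d * l) := by
    intro k hk l hl h0
    have hk := Finset.mem_range.1 hk
    have hl := Finset.mem_range.1 hl
    by_cases hdv : D ∣ k + d * l
    · have hl0 : 0 < l := by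
        rw [Nat.pos_iff_ne_zero]; rintro rfl
        rw [mul_zero, add_zero] at hdv
        exact h0 ⟨Nat.eq_zero_of_dvd_of_lt hdv hk, rfl⟩
      have hk0 : 0 < k := by
        rw [Nat.pos_iff_ne_zero]; rintro rfl
        rw [zero_add] at hdv
        exact h0 ⟨rfl, Nat.eq_zero_of_dvd_of_lt (hd l hdv) hl⟩
      have hc := comb17 ℓ m hm k l hk0 hk hl0 hl hdv
      have v1 := s.g_val hq3 k (by rw [hq]; exact hk)
      have v2 := s.g_val hq3 l (by rw [hq]; exact hl)
      have v3 := mul_dvd_mul v1 v2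
      rw [← pow_add] at v3
      exact (((((pow_dvd_pow _ hc).trans v3).mul_right _).mul_right _).mul_right _)
    · rw [s.orth1 _ (by rw [hq]; exact hdv), mul_zero]
      exact dvd_zero _
  have h00 : (0, 0) ∈ Finset.range D ×ˢ Finset.range D := by
    simp; omega
  rw [sum_units, mul_add, e2, ← Finset.sum_product', ← Finset.add_sum_erase _ _ h00]
  have hzero : (D : R) ^ 2 * s.ψ ((a : F) * 0 + b * 0 ^ d) + (s.g 0 * s.g 0 * s.T a ^ 0 * s.T b ^ 0) *
        ∑ x : Fˣ, s.T x ^ (0 + d * 0) = (D : R) * 3 ^ m := by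
    rw [s.orth2 _ (by simp), hq, ← hD, g_zero]
    have : (3 : R) ^ m = D + 1 := by
      have : 3 ^ m = D + 1 := by omega
      exact_mod_cast congrArg (Nat.cast (R := R)) this
    rw [this]
    simp [hdd, s.ψ0]; ring
  rw [← add_assoc]
  apply dvd_add
  · show _ ∣ (D : R) ^ 2 * s.ψ ((a : F) * 0 + b * 0 ^ d) + (s.g 0 * s.g 0 * s.T a ^ 0 * s.T b ^ 0) *
        ∑ x : Fˣ, s.T x ^ (0 + d * 0)
    rw [hzero, s.lam_three, mul_pow, ← pow_mul]
    exact ((pow_dvd_pow _ (by omega)).mul_left _).mul_left _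
  · refine Finset.dvd_sum ?_
    rintro ⟨k, l⟩ hkl
    rw [Finset.mem_erase, Finset.mem_product] at hkl
    exact hterm k hkl.2.1 l hkl.2.2 (fun h => hkl.1 (by rw [h.1, h.2]))

end Setup17

section Concrete17
variable {F : Type*} [Field F] [Fintype F] [DecidableEq F] [Algebra (ZMod 3) F] [CharP F 3]

/-- Witt vector divisibility descends to the integers. -/
lemma witt_dvd17 (F : Type*) [Field F] [Fintype F] [CharP F 3] (k : ℕ) : ∀ n : ℤ,
    ((3 : WittVector 3 F) ^ k ∣ (n : WittVector 3 F)) → (3 : ℤ) ^ k ∣ n := by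
  induction k with
  | zero => intro n _; simp
  | succ k ih =>
    intro n hn
    have h3 : (3 : ℤ) ∣ n := by
      have h1 : (3 : WittVector 3 F) ∣ (n : WittVector 3 F) := (dvd_pow_self _ (by omega)).trans hn
      have h2 := map_dvd (WittVector.constantCoeff : WittVector 3 F →+* F) h1
      rw [map_intCast] at h2
      have h4 : (WittVector.constantCoeff : WittVector 3 F →+* F) 3 = 0 := by
        rw [map_ofNat]
        exact_mod_cast CharP.cast_eq_zero F 3
      rw [h4, zero_dvd_iff] at h2
      exact (CharP.intCast_eq_zero_iff F 3 n).1 h2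
    obtain ⟨c, rfl⟩ := h3
    have hne : (3 : WittVector 3 F) ≠ 0 := by
      have := WittVector.p_nonzero 3 F
      exact_mod_cast this
    push_cast at hn
    rw [pow_succ', mul_dvd_mul_iff_left hne] at hn
    rw [pow_succ']
    exact mul_dvd_mul_left _ (ih c hn)

/-- The quadratic extension by a cube root of unity. -/
abbrev Rw17 (F : Type*) [Field F] [Fintype F] : Type _ :=
  QuadraticAlgebra (WittVector 3 F) (-1) (-1)

lemma rw_dvd17 (k : ℕ) (n : ℤ) (h : (3 : Rw17 F) ^ k ∣ (n : Rw17 F)) : (3 : ℤ) ^ k ∣ n := by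
  apply witt_dvd17 F
  have e : (3 : Rw17 F) ^ k = algebraMap (WittVector 3 F) (Rw17 F) (3 ^ k) := by
    rw [map_pow, map_ofNat]
  rw [e, QuadraticAlgebra.algebraMap_dvd_iff] at h
  simpa using h.1

lemma rw_inj17 (n : ℤ) (h : (n : Rw17 F) = 0) : n = 0 := by
  have h1 : (3 : ℤ) ^ (n.natAbs) ∣ n := by
    apply rw_dvd17 (F := F)
    rw [h]; exact dvd_zero _
  by_contra hn
  have h2 := Int.le_of_dvd (abs_pos.2 hn) ((dvd_abs _ _).2 h1)
  rw [Int.abs_eq_natAbs] at h2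
  have h3 : n.natAbs < 3 ^ n.natAbs := Nat.lt_pow_self (by norm_num)
  have h4 : (3 : ℤ) ^ n.natAbs = ((3 ^ n.natAbs : ℕ) : ℤ) := by push_cast; rfl
  rw [h4] at h2
  exact absurd (Int.ofNat_le.1 h2) (by omega)

/-- The trace. -/
noncomputable abbrev tr17 (x : F) : ZMod 3 := Algebra.trace (ZMod 3) F x

lemma tr_cube17 (x : F) : tr17 (x ^ 3) = tr17 x := by
  have h := Algebra.trace_eq_of_algEquiv (FiniteField.frobeniusAlgEquivOfAlgebraic (ZMod 3) F) x
  have h2 := congrFun (FiniteField.coe_frobeniusAlgEquivOfAlgebraic (ZMod 3) F) x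
  simp only [ZMod.card] at h2
  rw [h2] at h
  exact h

lemma tr_surj17 : ∃ z : F, tr17 z = 1 := by
  have : FiniteDimensional (ZMod 3) F := Module.Finite.of_finite
  exact Algebra.trace_surjective (ZMod 3) F 1

/-- cube root of unity -/
noncomputable def om17 (F : Type*) [Field F] [Fintype F] : Rw17 F := ⟨0, 1⟩

lemma om_eq17 : 1 + om17 F + om17 F ^ 2 = 0 := by
  rw [pow_two]
  apply QuadraticAlgebra.ext <;> simp [om17, QuadraticAlgebra.re_one, QuadraticAlgebra.im_one]

lemma om_cube17 : om17 F ^ 3 = 1 := by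
  linear_combination (om17 F - 1) * om_eq17 (F := F)

/-- additive character -/
noncomputable def psi17 (x : F) : Rw17 F := om17 F ^ (tr17 x).val

lemma om_val17 (a b : ZMod 3) : om17 F ^ (a + b).val = om17 F ^ a.val * om17 F ^ b.val := by
  rw [← pow_add, ZMod.val_add]
  conv_rhs => rw [← Nat.mod_add_div (a.val + b.val) 3, pow_add, pow_mul, om_cube17, one_pow, mul_one]

lemma psi_add17 (x y : F) : psi17 (x + y) = psi17 x * psi17 y := by
  unfold psi17
  rw [← om_val17, tr17, tr17, tr17, map_add]

lemma psi_zero17 : psi17 (0 : F) = 1 := by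
  simp [psi17, tr17]

lemma three_cancel17 (x : Rw17 F) (h : 3 * x = 0) : x = 0 := by
  have hne : (3 : WittVector 3 F) ≠ 0 := by
    have := WittVector.p_nonzero 3 F
    exact_mod_cast this
  have h1 := congrArg QuadraticAlgebra.re h
  have h2 := congrArg QuadraticAlgebra.im h
  simp [QuadraticAlgebra.re_ofNat, QuadraticAlgebra.im_ofNat] at h1 h2
  apply QuadraticAlgebra.ext
  · simpa [hne] using h1
  · simpa [hne] using h2

lemma psi_sum17 : ∑ x : F, psi17 x = 0 := by
  obtain ⟨z, hz⟩ := tr_surj17 (F := F)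
  have h1 : ∑ x : F, psi17 x = om17 F * ∑ x : F, psi17 x := by
    rw [Finset.mul_sum, ← Equiv.sum_comp (Equiv.addLeft z)]
    refine Finset.sum_congr rfl fun x _ => ?_
    rw [Equiv.coe_addLeft, psi_add17]
    congr 1
    rw [psi17, hz]
    have : (1 : ZMod 3).val = 1 := rfl
    rw [this, pow_one]
  apply three_cancel17
  linear_combination (om17 F + 2) * h1 + (∑ x : F, psi17 x) * om_eq17 (F := F)

end Concrete17

section Sums17
variable {F : Type*} [Field F] [Fintype F] [DecidableEq F] [Algebra (ZMod 3) F] [CharP F 3]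

lemma sig_sig17 (ℓ : ℕ) (hq : Fintype.card F = 3 ^ (2 * ℓ + 1)) (x : F) :
    ((x ^ 3 ^ ℓ) ^ 3 ^ ℓ) ^ 3 = x := by
  have h := FiniteField.pow_card x
  rw [hq] at h
  rw [← pow_mul, ← pow_mul]
  convert h using 2
  ring

lemma vpow_one17 (ℓ : ℕ) (hq : Fintype.card F = 3 ^ (2 * ℓ + 1)) (x : F)
    (hx : x ^ (2 * 3 ^ ℓ + 1) = 1) : x = 1 := by
  have h0 := sig_sig17 ℓ hq x
  set s := x ^ 3 ^ ℓ with hs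
  have h1 : s ^ 2 * x = 1 := by
    rw [← hx, hs, ← pow_mul, pow_succ, mul_comm 2]
  have h2 : s ^ 3 * x ^ 2 = 1 := by
    have := congrArg (fun y => (y ^ 3 ^ ℓ) ^ 3) h1
    simp only [mul_pow, one_pow] at this
    rw [← hs, ← pow_mul s, mul_comm 2, pow_mul s, ← pow_mul (s ^ 3 ^ ℓ), mul_comm 2, pow_mul, h0] at this
    rw [mul_comm]; exact this
  have hs1 : s = 1 := by
    have h4 : (s ^ 2 * x) ^ 2 = 1 := by rw [h1, one_pow]
    calc s = s * (s ^ 3 * x ^ 2) := by rw [h2, mul_one]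
      _ = (s ^ 2 * x) ^ 2 := by ring
      _ = 1 := h4
  rw [hs1] at h1
  simpa using h1

lemma vpow_bij17 (ℓ : ℕ) (hq : Fintype.card F = 3 ^ (2 * ℓ + 1)) :
    Function.Bijective (fun x : F => x ^ (2 * 3 ^ ℓ + 1)) := by
  rw [← Finite.injective_iff_bijective]
  intro x y hxy
  simp only at hxy
  by_cases hy : y = 0
  · subst hy
    rw [zero_pow (by omega)] at hxy
    exact eq_zero_of_pow_eq_zero hxy
  · have : (x / y) ^ (2 * 3 ^ ℓ + 1) = 1 := by
      rw [div_pow, hxy, div_self (pow_ne_zero _ hy)]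
    have := vpow_one17 ℓ hq _ this
    rwa [div_eq_one_iff_eq hy] at this

lemma hd17 (ℓ : ℕ) (hq : Fintype.card F = 3 ^ (2 * ℓ + 1)) (l : ℕ)
    (h : 3 ^ (2 * ℓ + 1) - 1 ∣ (2 * 3 ^ ℓ + 1) * l) : 3 ^ (2 * ℓ + 1) - 1 ∣ l := by
  obtain ⟨p, hp⟩ := IsCyclic.exists_generator (α := Fˣ)
  have ho : orderOf p = 3 ^ (2 * ℓ + 1) - 1 := by
    rw [orderOf_eq_card_of_forall_mem_zpowers hp, Nat.card_eq_fintype_card, Fintype.card_units, hq]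
  rw [← ho] at h ⊢
  rw [orderOf_dvd_iff_pow_eq_one] at h ⊢
  have h1 : (((p ^ l : Fˣ) : F)) ^ (2 * 3 ^ ℓ + 1) = 1 := by
    rw [← Units.val_pow_eq_pow_val, ← pow_mul, mul_comm, h, Units.val_one]
  exact Units.ext (vpow_one17 ℓ hq _ h1)

/-- The concrete setup. -/
noncomputable def setup17 (F : Type*) [Field F] [Fintype F] [DecidableEq F] [Algebra (ZMod 3) F]
    [CharP F 3] : Setup17 F (WittVector 3 F) (Rw17 F) where
  ι := algebraMap _ _
  τ := WittVector.teichmuller 3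
  res := WittVector.constantCoeff
  ω := om17 F
  ψ := psi17
  τ0 := WittVector.teichmuller_zero 3
  resτ := fun x => WittVector.teichmuller_coeff_zero 3 x
  unit := fun w hw => WittVector.isUnit_of_coeff_zero_ne_zero w hw
  hω := om_eq17
  ψ0 := psi_zero17
  ψadd := psi_add17
  ψlam := fun x => by
    unfold psi17
    simpa using sub_dvd_pow_sub_pow (om17 F) 1 (tr17 x).val
  ψcube := fun x => by rw [psi17, psi17, tr_cube17]
  ψsum := psi_sum17

/-- Number of x with given trace value -/
noncomputable def N17 (v : ℕ) (a b : F) (i : ZMod 3) : ℕ :=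
  (Finset.univ.filter fun x : F => tr17 (a * x + b * x ^ v) = i).card

/-- The exponential sum as an integer -/
noncomputable def S17 (v : ℕ) (a b : F) : ℤ := N17 v a b 0 - N17 v a b 1

lemma N_symm17 (v : ℕ) (hv : Odd v) (a b : F) : N17 v a b 2 = N17 v a b 1 := by
  unfold N17
  apply Finset.card_bij (fun x _ => -x)
  · intro x hx
    simp only [Finset.mem_filter, Finset.mem_univ, true_and] at hx ⊢
    have : a * -x + b * (-x) ^ v = -(a * x + b * x ^ v) := by rw [hv.neg_pow]; ring
    rw [this, tr17, map_neg]
    unfold tr17 at hx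
    rw [hx]; decide
  · intro x _ y _ h
    exact neg_injective h
  · intro y hy
    refine ⟨-y, ?_, neg_neg y⟩
    simp only [Finset.mem_filter, Finset.mem_univ, true_and] at hy ⊢
    have : a * -y + b * (-y) ^ v = -(a * y + b * y ^ v) := by rw [hv.neg_pow]; ring
    rw [this, tr17, map_neg]
    unfold tr17 at hy
    rw [hy]; decide

lemma N_total17 (v : ℕ) (a b : F) : N17 v a b 0 + N17 v a b 1 + N17 v a b 2 = Fintype.card F := by
  have h := Finset.card_eq_sum_card_fiberwise (f := fun x : F => tr17 (a * x + b * x ^ v))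
    (s := Finset.univ) (t := Finset.univ) (fun _ _ => Finset.mem_coe.2 (Finset.mem_univ _))
  rw [show (Finset.univ : Finset (ZMod 3)) = {0, 1, 2} from rfl] at h
  rw [Finset.sum_insert (by decide), Finset.sum_insert (by decide), Finset.sum_singleton] at h
  rw [← Finset.card_univ, h, add_assoc]
  rfl

lemma N_zero17 (v : ℕ) (hv : Odd v) (a b : F) :
    3 * (N17 v a b 0 : ℤ) = 2 * S17 v a b + Fintype.card F := by
  have h1 := N_total17 v a b
  rw [N_symm17 v hv] at h1
  unfold S17
  rw [← h1]; push_cast; ring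

lemma S_cast17 (v : ℕ) (hv : Odd v) (a b : F) :
    (S17 v a b : Rw17 F) = ∑ x : F, psi17 (a * x + b * x ^ v) := by
  have h : ∀ t : ZMod 3, om17 F ^ t.val = (if t = 0 then 1 else 0) + (if t = 1 then 1 else 0) * om17 F
      + (if t = 2 then 1 else 0) * om17 F ^ 2 := by
    intro t
    have ht : t = 0 ∨ t = 1 ∨ t = 2 := by revert t; decide
    have v1 : (1 : ZMod 3).val = 1 := rfl
    have v2 : (2 : ZMod 3).val = 2 := rfl
    have h1 : ¬ ((2 : ZMod 3) = 0) := by decide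
    have h2 : ¬ ((2 : ZMod 3) = 1) := by decide
    have h3 : ¬ ((0 : ZMod 3) = 2) := by decide
    have h4 : ¬ ((1 : ZMod 3) = 2) := by decide
    rcases ht with rfl | rfl | rfl
    · simp [h3]
    · simp [v1, h4]
    · simp [v2, h1, h2]
  unfold psi17
  simp_rw [h]
  rw [Finset.sum_add_distrib, Finset.sum_add_distrib, ← Finset.sum_mul, ← Finset.sum_mul,
    Finset.sum_boole, Finset.sum_boole, Finset.sum_boole]
  change _ = (N17 v a b 0 : Rw17 F) + (N17 v a b 1 : Rw17 F) * om17 F + (N17 v a b 2 : Rw17 F) * om17 F ^ 2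
  rw [N_symm17 v hv, S17]
  push_cast
  linear_combination (-(N17 v a b 1 : Rw17 F)) * om_eq17 (F := F)

lemma psi_lin17 (A : F) : ∑ a : F, psi17 (a * A) = if A = 0 then (Fintype.card F : Rw17 F) else 0 := by
  split_ifs with h
  · simp [h, psi_zero17]
  · rw [← psi_sum17 (F := F)]
    exact Equiv.sum_comp (Equiv.mulRight₀ A h) psi17

lemma S_b0_17 (v : ℕ) (hv : Odd v) (a : F) (ha : a ≠ 0) : S17 v a 0 = 0 := by
  apply rw_inj17 (F := F)
  rw [S_cast17 v hv]
  have := psi_lin17 a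
  rw [if_neg ha] at this
  rw [← this]
  refine Finset.sum_congr rfl fun x _ => ?_
  congr 1; ring

lemma S_a0_17 (ℓ : ℕ) (hq : Fintype.card F = 3 ^ (2 * ℓ + 1)) (b : F) (hb : b ≠ 0) :
    S17 (2 * 3 ^ ℓ + 1) 0 b = 0 := by
  apply rw_inj17 (F := F)
  rw [S_cast17 _ ⟨_, rfl⟩]
  have := psi_lin17 b
  rw [if_neg hb] at this
  rw [← this, ← Equiv.sum_comp (Equiv.ofBijective _ (vpow_bij17 ℓ hq)) (fun y => psi17 (y * b))]
  refine Finset.sum_congr rfl fun x _ => ?_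
  congr 1
  simp only [Equiv.ofBijective_apply]; ring

lemma S_00_17 (v : ℕ) : S17 v (0 : F) 0 = Fintype.card F := by
  unfold S17 N17
  simp [tr17]

lemma S_dvd17 (ℓ : ℕ) (hℓ : 1 ≤ ℓ) (hq : Fintype.card F = 3 ^ (2 * ℓ + 1)) (a b : F) (hb : b ≠ 0) :
    (3 : ℤ) ^ (ℓ + 1) ∣ S17 (2 * 3 ^ ℓ + 1) a b := by
  by_cases ha : a = 0
  · subst ha
    rw [S_a0_17 ℓ hq b hb]; exact dvd_zero _
  have h := (setup17 F).S_val ℓ _ rfl hℓ hq (hd17 ℓ hq) (Units.mk0 a ha) (Units.mk0 b hb)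
  change (om17 F - 1) ^ (2 * ℓ + 1 + 1) ∣ ((3 ^ (2 * ℓ + 1) - 1 : ℕ) : Rw17 F) ^ 2 *
    ∑ x : F, psi17 (a * x + b * x ^ (2 * 3 ^ ℓ + 1)) at h
  rw [← S_cast17 _ ⟨_, rfl⟩] at h
  have h3 : (3 : Rw17 F) ^ (ℓ + 1) ∣ (((3 ^ (2 * ℓ + 1) - 1 : ℕ) : ℤ) ^ 2 * S17 (2 * 3 ^ ℓ + 1) a b : ℤ) := by
    push_cast
    refine dvd_trans ?_ h
    have e : (3 : Rw17 F) * (-om17 F) = (om17 F - 1) ^ 2 := by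
      have e1 : (3 : Rw17 F) = - om17 F ^ 2 * (om17 F - 1) ^ 2 := (setup17 F).lam_three
      rw [e1]
      linear_combination (om17 F - 1) ^ 2 * om_cube17 (F := F)
    have e2 : (om17 F - 1) ^ (2 * ℓ + 1 + 1) = ((om17 F - 1) ^ 2) ^ (ℓ + 1) := by
      rw [← pow_mul]; ring_nf
    rw [e2, ← e, mul_pow]
    exact dvd_mul_right _ _
  have h4 := rw_dvd17 _ _ h3
  refine IsCoprime.dvd_of_dvd_mul_left ?_ h4
  apply IsCoprime.pow
  have h5 : ((3 ^ (2 * ℓ + 1) - 1 : ℕ) : ℤ) = 3 * 3 ^ (2 * ℓ) - 1 := by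
    rw [Nat.cast_sub (Nat.one_le_pow _ _ (by norm_num))]
    push_cast; ring
  rw [h5]
  exact ⟨3 ^ (2 * ℓ), -1, by ring⟩

end Sums17

section Moments17
variable {F : Type*} [Field F] [Fintype F] [DecidableEq F] [Algebra (ZMod 3) F] [CharP F 3]

/-- solutions of the power system -/
noncomputable def sol17 (F : Type*) [Field F] [Fintype F] [DecidableEq F] (v n : ℕ) :
    Finset (Fin n → F) :=
  Finset.univ.filter fun p => ∑ i, p i = 0 ∧ ∑ i, p i ^ v = 0

lemma psi_sum_arg17 {n : ℕ} (f : Fin n → F) : ∏ i, psi17 (f i) = psi17 (∑ i, f i) := by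
  induction n with
  | zero => simp [psi_zero17]
  | succ n ih => rw [Fin.prod_univ_succ, Fin.sum_univ_succ, psi_add17, ih]

lemma moment17 (v n : ℕ) (hv : Odd v) :
    ∑ b : F, ∑ a : F, S17 v a b ^ n = (Fintype.card F : ℤ) ^ 2 * (sol17 F v n).card := by
  have key : ((∑ b : F, ∑ a : F, S17 v a b ^ n - (Fintype.card F : ℤ) ^ 2 * (sol17 F v n).card : ℤ) :
      Rw17 F) = 0 := by
    push_cast
    rw [sub_eq_zero]
    simp_rw [S_cast17 v hv, Fintype.sum_pow, psi_sum_arg17]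
    have e1 : ∀ (a b : F) (p : Fin n → F), psi17 (∑ i, (a * p i + b * p i ^ v)) =
        psi17 (a * ∑ i, p i) * psi17 (b * ∑ i, p i ^ v) := by
      intro a b p
      rw [← psi_add17, Finset.sum_add_distrib, Finset.mul_sum, Finset.mul_sum]
    simp_rw [e1]
    have e2 : ∀ b : F, ∑ a : F, ∑ p : Fin n → F, psi17 (a * ∑ i, p i) * psi17 (b * ∑ i, p i ^ v) =
        ∑ p : Fin n → F, ∑ a : F, psi17 (a * ∑ i, p i) * psi17 (b * ∑ i, p i ^ v) :=
      fun b => Finset.sum_comm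
    simp_rw [e2, ← Finset.sum_mul]
    rw [Finset.sum_comm]
    simp_rw [← Finset.mul_sum, psi_lin17]
    have e3 : ∀ p : Fin n → F, ((if ∑ i, p i = 0 then (Fintype.card F : Rw17 F) else 0) *
        if ∑ i, p i ^ v = 0 then (Fintype.card F : Rw17 F) else 0) =
        (Fintype.card F : Rw17 F) ^ 2 * if (∑ i, p i = 0 ∧ ∑ i, p i ^ v = 0) then 1 else 0 := by
      intro p
      by_cases h1 : ∑ i, p i = 0 <;> by_cases h2 : ∑ i, p i ^ v = 0 <;> simp [h1, h2, pow_two]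
    simp_rw [e3]
    rw [← Finset.mul_sum, Finset.sum_boole]
    rfl
  have := rw_inj17 _ key
  omega

lemma sol_two17 (v : ℕ) (hv : Odd v) : Fintype.card F ≤ (sol17 F v 2).card := by
  rw [← Finset.card_univ]
  apply Finset.card_le_card_of_injOn (fun x : F => ![x, -x])
  · intro x _
    simp [sol17, hv.neg_pow]
  · intro x _ y _ h
    simpa using congrFun h 0

lemma two_ne17 (F : Type*) [Field F] [CharP F 3] : (2 : F) ≠ 0 := by
  intro h
  have h3 : ((3 : ℕ) : F) = 0 := CharP.cast_eq_zero F 3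
  push_cast at h3
  have : (1 : F) = 0 := by linear_combination h3 - h
  exact one_ne_zero this

lemma three_eq17 (F : Type*) [Field F] [CharP F 3] : (3 : F) = 0 := by
  have h3 : ((3 : ℕ) : F) = 0 := CharP.cast_eq_zero F 3
  exact_mod_cast h3

lemma conic17 : (Finset.univ.filter fun A : F × F × F =>
    A.1 ^ 2 + A.2.1 ^ 2 + A.2.2 ^ 2 = 0 ∧ A ≠ 0).card ≤ Fintype.card F ^ 2 - 1 := by
  have hc : Fintype.card F ^ 2 - 1 = ((Finset.univ : Finset (F × F)).erase 0).card := by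
    rw [Finset.card_erase_of_mem (Finset.mem_univ _), Finset.card_univ, Fintype.card_prod, pow_two]
  have h3 := three_eq17 F
  have h2 := two_ne17 F
  rw [hc]
  apply Finset.card_le_card_of_injOn
    (fun A : F × F × F => if A.1 = A.2.2 ∧ A.2.1 = A.2.2 then (A.2.2, -A.2.2)
      else (A.1 - A.2.2, A.2.1 - A.2.2))
  · rintro ⟨a, b, c⟩ h
    simp only [Finset.coe_filter, Finset.mem_univ, true_and, Set.mem_ofPred_eq] at h
    simp only [Finset.coe_erase, Finset.coe_univ, Set.mem_sdiff, Set.mem_univ, true_and,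
      Set.mem_singleton_iff]
    split_ifs with hs
    · obtain ⟨rfl, rfl⟩ := hs
      intro h0
      apply h.2
      have : b = 0 := congrArg Prod.fst h0
      simp [this]
    · intro h0
      apply hs
      exact ⟨sub_eq_zero.1 (congrArg Prod.fst h0), sub_eq_zero.1 (congrArg Prod.snd h0)⟩
  · have aux : ∀ a b c : F, a ^ 2 + b ^ 2 + c ^ 2 = 0 → (a - c) + (b - c) = 0 → a = c ∧ b = c := by
      intro a b c h hab
      have e : 2 * (a - c) ^ 2 = 0 := by
        linear_combination h - (b - c - (a - c)) * hab - c ^ 2 * h3 - 2 * c * hab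
      have e2 : a - c = 0 := by
        rcases mul_eq_zero.1 e with e | e
        · exact absurd e h2
        · exact eq_zero_of_pow_eq_zero e
      exact ⟨sub_eq_zero.1 e2, by linear_combination hab - e2⟩
    rintro ⟨a, b, c⟩ h ⟨a', b', c'⟩ h' heq
    simp only [Finset.coe_filter, Finset.mem_univ, true_and, Set.mem_ofPred_eq] at h h' heq
    split_ifs at heq with hs hs' hs'
    · obtain ⟨rfl, rfl⟩ := hs
      obtain ⟨rfl, rfl⟩ := hs'
      have : b = b' := congrArg Prod.fst heq
      rw [this]
    · have e1 := congrArg Prod.fst heq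
      have e2 := congrArg Prod.snd heq
      simp only at e1 e2
      exact absurd (aux a' b' c' h'.1 (by linear_combination -e1 - e2)) hs'
    · have e1 := congrArg Prod.fst heq
      have e2 := congrArg Prod.snd heq
      simp only at e1 e2
      exact absurd (aux a b c h.1 (by linear_combination e1 + e2)) hs
    · have e1 := congrArg Prod.fst heq
      have e2 := congrArg Prod.snd heq
      simp only at e1 e2
      have hne : (a - c) + (b - c) ≠ 0 := fun h0 => hs (aux a b c h.1 h0)
      have e3 : (2 * ((a - c) + (b - c))) * (c - c') = 0 := by
        have ha : a' = a - c + c' := by linear_combination -e1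
        have hb : b' = b - c + c' := by linear_combination -e2
        have hh := h'.1
        rw [ha, hb] at hh
        linear_combination h.1 - hh - (c ^ 2 - c' ^ 2) * h3
      have e4 : c - c' = 0 := by
        rcases mul_eq_zero.1 e3 with e | e
        · exact absurd e (mul_ne_zero h2 hne)
        · exact e
      have hc' : c = c' := sub_eq_zero.1 e4
      subst hc'
      rw [sub_left_inj] at e1 e2
      rw [e1, e2]

lemma exists_h17 (ℓ : ℕ) (hq : Fintype.card F = 3 ^ (2 * ℓ + 1)) :
    ∃ h : ℕ, Odd h ∧ ∀ x : F, x ≠ 0 → x ^ 3 ^ ℓ = (x ^ h) ^ 2 * x := by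
  have h1 : Odd (3 ^ ℓ) := Odd.pow (by decide)
  obtain ⟨k, hk⟩ := h1
  rcases Nat.even_or_odd k with he | ho
  · have h2 : 3 ^ (2 * ℓ + 1) = 2 * (2 * (3 * k ^ 2 + 3 * k) + 1) + 1 := by
      have : 3 ^ (2 * ℓ + 1) = 3 * (3 ^ ℓ * 3 ^ ℓ) := by ring
      rw [this, hk]
      ring
    refine ⟨k + (2 * (3 * k ^ 2 + 3 * k) + 1), he.add_odd ⟨_, rfl⟩, fun x hx => ?_⟩
    have h4 := FiniteField.pow_card_sub_one_eq_one x hx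
    rw [hq, h2, Nat.add_sub_cancel] at h4
    rw [hk, ← pow_mul, add_mul, pow_add x (k * 2), mul_comm _ 2, mul_comm _ 2, h4, mul_one, pow_succ]
  · refine ⟨k, ho, fun x _ => ?_⟩
    rw [hk, ← pow_mul, ← pow_succ, mul_comm]

lemma h_inj17 (ℓ : ℕ) (hq : Fintype.card F = 3 ^ (2 * ℓ + 1)) (h : ℕ) (ho : Odd h)
    (hh : ∀ x : F, x ≠ 0 → x ^ 3 ^ ℓ = (x ^ h) ^ 2 * x) (x y : F) (hx : x ≠ 0) (hy : y ≠ 0)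
    (hxy : x ^ h = y ^ h) : x = y := by
  have h1 : (x / y) ^ h = 1 := by rw [div_pow, hxy, div_self (pow_ne_zero _ hy)]
  have hr : x / y ≠ 0 := div_ne_zero hx hy
  have h2 := hh _ hr
  rw [h1, one_pow, one_mul] at h2
  have h3 := sig_sig17 ℓ hq (x / y)
  rw [h2, h2] at h3
  rw [← div_eq_one_iff_eq hy]
  generalize x / y = r at *
  have h4 : r ^ 2 = 1 := by
    have : r * (r ^ 2) = r * 1 := by linear_combination h3
    exact mul_left_cancel₀ hr this
  rcases mul_self_eq_one_iff.1 ((pow_two r).symm.trans h4) with h5 | h5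
  · exact h5
  · rw [h5, ho.neg_one_pow] at h1
    exact absurd (by linear_combination -h1) (two_ne17 F)

/-- The trilinear form -/
def M17 (ℓ : ℕ) (e : F × F × F) : F :=
  e.1 * e.2.1 ^ 3 ^ ℓ * e.2.2 ^ 3 ^ ℓ + e.2.1 * e.1 ^ 3 ^ ℓ * e.2.2 ^ 3 ^ ℓ
    + e.2.2 * e.1 ^ 3 ^ ℓ * e.2.1 ^ 3 ^ ℓ

lemma M_nonzero17 (ℓ : ℕ) (hq : Fintype.card F = 3 ^ (2 * ℓ + 1)) :
    (Finset.univ.filter fun e : F × F × F =>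
      (e.1 ≠ 0 ∧ e.2.1 ≠ 0 ∧ e.2.2 ≠ 0) ∧ M17 ℓ e = 0).card ≤ Fintype.card F ^ 2 - 1 := by
  obtain ⟨h, ho, hh⟩ := exists_h17 ℓ hq
  refine le_trans ?_ (conic17 (F := F))
  apply Finset.card_le_card_of_injOn
    (fun e : F × F × F => ((e.1 ^ h)⁻¹, (e.2.1 ^ h)⁻¹, (e.2.2 ^ h)⁻¹))
  · rintro ⟨a, b, c⟩ H
    simp only [Finset.coe_filter, Finset.mem_univ, true_and, Set.mem_ofPred_eq] at H ⊢
    obtain ⟨⟨ha, hb, hc⟩, hM⟩ := H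
    have ha' := pow_ne_zero h ha
    have hb' := pow_ne_zero h hb
    have hc' := pow_ne_zero h hc
    refine ⟨?_, fun h0 => inv_ne_zero ha' (congrArg Prod.fst h0)⟩
    simp only [M17] at hM
    rw [hh a ha, hh b hb, hh c hc] at hM
    generalize a ^ h = A at *
    generalize b ^ h = B at *
    generalize c ^ h = C at *
    have e : (a * b * c) * (B ^ 2 * C ^ 2 + A ^ 2 * C ^ 2 + A ^ 2 * B ^ 2) = 0 := by
      linear_combination hM
    have e2 := (mul_eq_zero.1 e).resolve_left (mul_ne_zero (mul_ne_zero ha hb) hc)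
    field_simp
    linear_combination e2
  · rintro ⟨a, b, c⟩ H ⟨a', b', c'⟩ H' heq
    simp only [Finset.coe_filter, Finset.mem_univ, true_and, Set.mem_ofPred_eq] at H H'
    simp only [Prod.mk.injEq, inv_inj] at heq
    rw [h_inj17 ℓ hq h ho hh a a' H.1.1 H'.1.1 heq.1,
      h_inj17 ℓ hq h ho hh b b' H.1.2.1 H'.1.2.1 heq.2.1,
      h_inj17 ℓ hq h ho hh c c' H.1.2.2 H'.1.2.2 heq.2.2]

lemma M_count17 (ℓ : ℕ) (hq : Fintype.card F = 3 ^ (2 * ℓ + 1)) :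
    (((Finset.univ.filter fun e : F × F × F => M17 ℓ e = 0).card : ℕ) : ℤ) ≤
      4 * (Fintype.card F : ℤ) ^ 2 - 3 * Fintype.card F := by
  have h1 := M_nonzero17 (F := F) ℓ hq
  have hpos : 0 < Fintype.card F := Fintype.card_pos
  have h2 : (Finset.univ.filter fun e : F × F × F => (e.1 ≠ 0 ∧ e.2.1 ≠ 0 ∧ e.2.2 ≠ 0)).card =
      (Fintype.card F - 1) * ((Fintype.card F - 1) * (Fintype.card F - 1)) := by
    have : (Finset.univ.filter fun e : F × F × F => (e.1 ≠ 0 ∧ e.2.1 ≠ 0 ∧ e.2.2 ≠ 0)) =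
        (Finset.univ.erase 0) ×ˢ ((Finset.univ.erase 0) ×ˢ (Finset.univ.erase 0)) := by
      ext ⟨a, b, c⟩; simp
    rw [this, Finset.card_product, Finset.card_product,
      Finset.card_erase_of_mem (Finset.mem_univ _), Finset.card_univ]
  have h3 := Finset.card_filter_add_card_filter_not (s := (Finset.univ : Finset (F × F × F)))
    (fun e : F × F × F => (e.1 ≠ 0 ∧ e.2.1 ≠ 0 ∧ e.2.2 ≠ 0))
  rw [Finset.card_univ, Fintype.card_prod, Fintype.card_prod, h2] at h3
  have h4 : (Finset.univ.filter fun e : F × F × F => M17 ℓ e = 0).card ≤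
      (Finset.univ.filter fun e : F × F × F =>
      (e.1 ≠ 0 ∧ e.2.1 ≠ 0 ∧ e.2.2 ≠ 0) ∧ M17 ℓ e = 0).card +
      (Finset.univ.filter fun e : F × F × F => ¬ (e.1 ≠ 0 ∧ e.2.1 ≠ 0 ∧ e.2.2 ≠ 0)).card := by
    refine le_trans (Finset.card_le_card ?_) (Finset.card_union_le _ _)
    intro e he
    simp only [Finset.mem_union, Finset.mem_filter, Finset.mem_univ, true_and] at he ⊢
    tauto
  generalize Fintype.card F = q at *
  obtain ⟨r, rfl⟩ : ∃ r, q = r + 1 := ⟨q - 1, by omega⟩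
  rw [Nat.add_sub_cancel] at h3
  have h5 : (r + 1) ^ 2 - 1 = r ^ 2 + 2 * r := by
    have : (r + 1) ^ 2 = r ^ 2 + 2 * r + 1 := by ring
    omega
  rw [h5] at h1
  zify at h1 h3 h4
  push_cast
  nlinarith

lemma sol_four17 (ℓ : ℕ) (hq : Fintype.card F = 3 ^ (2 * ℓ + 1)) :
    ((sol17 F (2 * 3 ^ ℓ + 1) 4).card : ℤ) ≤ 4 * (Fintype.card F : ℤ) ^ 2 - 3 * Fintype.card F := by
  refine le_trans ?_ (M_count17 (F := F) ℓ hq)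
  rw [Nat.cast_le]
  apply Finset.card_le_card_of_injOn (fun p : Fin 4 → F => (p 0 + p 1, p 0 + p 2, p 1 + p 2))
  · intro p hp
    simp only [sol17, Finset.coe_filter, Finset.mem_univ, true_and, Set.mem_ofPred_eq,
      Fin.sum_univ_four] at hp ⊢
    obtain ⟨h1, h2⟩ := hp
    have hf : ∀ x : F, x ^ (2 * 3 ^ ℓ + 1) = x * (x ^ 3 ^ ℓ) ^ 2 := by
      intro x; rw [← pow_mul, ← pow_succ', mul_comm]
    have : Fact (Nat.Prime 3) := ⟨Nat.prime_three⟩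
    have h3 : p 3 = -(p 0 + p 1 + p 2) := by linear_combination h1
    have ho : Odd (3 ^ ℓ) := Odd.pow (by decide)
    simp only [M17]
    rw [hf, hf, hf, hf, h3, ho.neg_pow, add_pow_char_pow, add_pow_char_pow] at h2
    rw [add_pow_char_pow, add_pow_char_pow, add_pow_char_pow]
    linear_combination -h2
  · intro p hp p' hp' heq
    simp only [sol17, Finset.coe_filter, Finset.mem_univ, true_and, Set.mem_ofPred_eq,
      Fin.sum_univ_four] at hp hp'
    simp only [Prod.mk.injEq] at heq
    obtain ⟨e1, e2, e3⟩ := heq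
    have h0 : p 0 = p' 0 := by
      apply mul_left_cancel₀ (two_ne17 F)
      linear_combination e1 + e2 - e3
    have h1 : p 1 = p' 1 := by linear_combination e1 - h0
    have h2 : p 2 = p' 2 := by linear_combination e2 - h0
    have h3 : p 3 = p' 3 := by linear_combination hp.1 - hp'.1 - h0 - h1 - h2
    funext i
    fin_cases i
    · exact h0
    · exact h1
    · exact h2
    · exact h3

lemma S_three17 (ℓ : ℕ) (hℓ : 1 ≤ ℓ) (hq : Fintype.card F = 3 ^ (2 * ℓ + 1)) (a b : F) (hb : b ≠ 0) :
    S17 (2 * 3 ^ ℓ + 1) a b = 0 ∨ S17 (2 * 3 ^ ℓ + 1) a b = 3 ^ (ℓ + 1) ∨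
      S17 (2 * 3 ^ ℓ + 1) a b = -3 ^ (ℓ + 1) := by
  have hv : Odd (2 * 3 ^ ℓ + 1) := ⟨_, rfl⟩
  set v := 2 * 3 ^ ℓ + 1 with hvd
  have hq3 : 3 * (Fintype.card F : ℤ) = (3 ^ (ℓ + 1)) ^ 2 := by
    rw [hq]; push_cast; ring
  have m2 := moment17 (F := F) v 2 hv
  have m4 := moment17 (F := F) v 4 hv
  have c2 : (Fintype.card F : ℤ) ≤ (sol17 F v 2).card := by exact_mod_cast sol_two17 v hv
  have c4 := sol_four17 (F := F) ℓ hq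
  rw [← hvd] at c4
  have z : ∀ n : ℕ, n ≠ 0 → ∑ a : F, S17 v a 0 ^ n = (Fintype.card F : ℤ) ^ n := by
    intro n hn
    rw [Finset.sum_eq_single 0, S_00_17]
    · intro a _ ha
      rw [S_b0_17 v hv a ha, zero_pow hn]
    · simp
  rw [← Finset.add_sum_erase _ _ (Finset.mem_univ (0 : F)), z _ (by norm_num)] at m2 m4
  have hterm : ∀ b ∈ Finset.univ.erase (0 : F), ∀ a ∈ (Finset.univ : Finset F),
      0 ≤ S17 v a b ^ 4 - 3 * (Fintype.card F : ℤ) * S17 v a b ^ 2 := by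
    intro b hb a _
    obtain ⟨c, hc⟩ := S_dvd17 ℓ hℓ hq a b (Finset.ne_of_mem_erase hb)
    rw [← hvd] at hc
    rw [hq3, hc]
    have : (3 ^ (ℓ + 1) * c) ^ 4 - (3 ^ (ℓ + 1)) ^ 2 * (3 ^ (ℓ + 1) * c) ^ 2 =
        ((3 : ℤ) ^ (ℓ + 1)) ^ 4 * (c ^ 2 * (c ^ 2 - 1)) := by ring
    rw [this]
    apply mul_nonneg (by positivity)
    rcases eq_or_ne c 0 with rfl | h0
    · simp
    · have : 0 < c ^ 2 := by positivity
      exact mul_nonneg this.le (by omega)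
  have hsum : ∑ b ∈ Finset.univ.erase (0 : F), ∑ a : F,
      (S17 v a b ^ 4 - 3 * (Fintype.card F : ℤ) * S17 v a b ^ 2) ≤ 0 := by
    simp_rw [Finset.sum_sub_distrib, ← Finset.mul_sum]
    have hqp : (0 : ℤ) ≤ Fintype.card F := by positivity
    generalize (Fintype.card F : ℤ) = q at *
    have i2 := mul_le_mul_of_nonneg_left c2 (pow_nonneg hqp 2)
    have i4 := mul_le_mul_of_nonneg_left c4 (pow_nonneg hqp 2)
    have i5 := mul_le_mul_of_nonneg_left i2 hqp
    rw [← m2] at i5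
    rw [← m4] at i4
    linarith
  have h0 := (Finset.sum_eq_zero_iff_of_nonneg (fun b hb => Finset.sum_nonneg (hterm b hb))).1
    (le_antisymm hsum (Finset.sum_nonneg fun b hb => Finset.sum_nonneg (hterm b hb)))
  have hb' : b ∈ Finset.univ.erase (0 : F) := by simp [hb]
  have h1 := (Finset.sum_eq_zero_iff_of_nonneg (hterm b hb')).1 (h0 b hb') a (Finset.mem_univ _)
  rw [hq3] at h1
  generalize S17 v a b = s at *
  have h2 : s ^ 2 * ((s - 3 ^ (ℓ + 1)) * (s + 3 ^ (ℓ + 1))) = 0 := by linear_combination h1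
  rcases mul_eq_zero.1 h2 with h | h
  · exact Or.inl (eq_zero_of_pow_eq_zero h)
  · rcases mul_eq_zero.1 h with h | h
    · right; left; linear_combination h
    · right; right; linear_combination h

end Moments17

section Weights17
variable {F : Type*} [Field F] [Fintype F] [DecidableEq F] [Algebra (ZMod 3) F] [CharP F 3]

/-- zeros with prescribed quadratic character -/
noncomputable def P17 (c v : ℕ) (a b ε : F) : ℕ :=
  (Finset.univ.filter fun x : F => x ^ c = ε ∧ tr17 (a * x + b * x ^ v) = 0).card

lemma P_neg17 (c v : ℕ) (hc : Odd c) (hv : Odd v) (a b : F) : P17 c v a b (-1) = P17 c v a b 1 := by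
  have e : ∀ x : F, tr17 (a * -x + b * (-x) ^ v) = -tr17 (a * x + b * x ^ v) := by
    intro x
    have : a * -x + b * (-x) ^ v = -(a * x + b * x ^ v) := by rw [hv.neg_pow]; ring
    rw [this, tr17, map_neg]
  unfold P17
  apply Finset.card_bij (fun x _ => -x)
  · intro x hx
    simp only [Finset.mem_filter, Finset.mem_univ, true_and] at hx ⊢
    rw [hc.neg_pow, hx.1, neg_neg, e, hx.2, neg_zero]
    exact ⟨rfl, rfl⟩
  · intro x _ y _ h
    exact neg_injective h
  · intro y hy
    refine ⟨-y, ?_, neg_neg y⟩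
    simp only [Finset.mem_filter, Finset.mem_univ, true_and] at hy ⊢
    rw [hc.neg_pow, hy.1, e, hy.2, neg_zero]
    exact ⟨rfl, rfl⟩

lemma neg_one_ne17 (F : Type*) [Field F] [CharP F 3] : (-1 : F) ≠ 1 := by
  intro h
  exact two_ne17 F (by linear_combination -h)

lemma char_val17 (c : ℕ) (hq : Fintype.card F = 2 * c + 1) (x : F) (hx : x ≠ 0) :
    x ^ c = 1 ∨ x ^ c = -1 := by
  have h := FiniteField.pow_card_sub_one_eq_one x hx
  rw [hq, Nat.add_sub_cancel, mul_comm, pow_mul, pow_two] at h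
  exact mul_self_eq_one_iff.1 h

lemma N_P17 (c v : ℕ) (hc : Odd c) (hv : Odd v) (hq : Fintype.card F = 2 * c + 1) (a b : F) :
    N17 v a b 0 = 1 + 2 * P17 c v a b 1 := by
  have hv0 : v ≠ 0 := by rintro rfl; exact absurd hv (by decide)
  have hc0 : c ≠ 0 := by rintro rfl; exact absurd hc (by decide)
  rw [two_mul]
  nth_rewrite 2 [← P_neg17 c v hc hv]
  unfold N17 P17
  rw [← Finset.card_singleton (0 : F), ← Finset.card_union_of_disjoint, ← Finset.card_union_of_disjoint]
  · congr 1
    ext x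
    simp only [Finset.mem_filter, Finset.mem_univ, true_and, Finset.mem_union, Finset.mem_singleton]
    constructor
    · intro h
      by_cases hx : x = 0
      · exact Or.inl hx
      · rcases char_val17 c hq x hx with h1 | h1
        · exact Or.inr (Or.inl ⟨h1, h⟩)
        · exact Or.inr (Or.inr ⟨h1, h⟩)
    · rintro (rfl | h | h)
      · simp [hv0, tr17]
      · exact h.2
      · exact h.2
  · rw [Finset.disjoint_left]
    intro x hx hx'
    simp only [Finset.mem_filter, Finset.mem_univ, true_and, Finset.mem_union,
      Finset.mem_singleton] at hx hx'
    subst hx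
    rw [zero_pow hc0] at hx'
    rcases hx' with h | h
    · exact zero_ne_one h.1
    · exact neg_ne_zero.2 one_ne_zero h.1.symm
  · rw [Finset.disjoint_left]
    intro x hx hx'
    simp only [Finset.mem_filter, Finset.mem_univ, true_and] at hx hx'
    exact neg_one_ne17 F (hx'.1.symm.trans hx.1)

lemma weight17 (c v : ℕ) (hc : Odd c) (hv : Odd v) (hq : Fintype.card F = 2 * c + 1) (a b : F) :
    3 * (((Finset.univ.erase (0 : F)).filter fun x => tr17 (a * x ^ (c + 1) + b * x ^ v) ≠ 0).card : ℤ) =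
      2 * Fintype.card F - S17 v a b - S17 v a (-b) := by
  have hc0 : c ≠ 0 := by rintro rfl; exact absurd hc (by decide)
  have h1 := N_zero17 v hv a b
  have h2 := N_zero17 v hv a (-b)
  rw [N_P17 c v hc hv hq] at h1 h2
  have h3 := Finset.card_filter_add_card_filter_not (s := Finset.univ.erase (0 : F))
    (fun x => tr17 (a * x ^ (c + 1) + b * x ^ v) ≠ 0)
  rw [Finset.card_erase_of_mem (Finset.mem_univ _), Finset.card_univ] at h3
  have h4 : ((Finset.univ.erase (0 : F)).filter fun x => ¬ tr17 (a * x ^ (c + 1) + b * x ^ v) ≠ 0).card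
      = P17 c v a b 1 + P17 c v a (-b) 1 := by
    rw [← P_neg17 c v hc hv a (-b)]
    unfold P17
    rw [← Finset.card_union_of_disjoint]
    · congr 1
      ext x
      simp only [Finset.mem_filter, Finset.mem_univ, true_and, Finset.mem_union, Finset.mem_erase,
        and_true, not_not]
      have e1 : x ^ c = 1 → tr17 (a * x ^ (c + 1) + b * x ^ v) = tr17 (a * x + b * x ^ v) := by
        intro h; rw [pow_succ, h, one_mul]
      have e2 : x ^ c = -1 → tr17 (a * x ^ (c + 1) + b * x ^ v) = -tr17 (a * x + -b * x ^ v) := by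
        intro h
        rw [pow_succ, h, tr17, tr17, ← map_neg]
        congr 1; ring
      constructor
      · rintro ⟨hx, h⟩
        rcases char_val17 c hq x hx with h1 | h1
        · left; exact ⟨h1, (e1 h1).symm.trans h⟩
        · right; exact ⟨h1, neg_eq_zero.1 ((e2 h1).symm.trans h)⟩
      · rintro (h | h)
        · refine ⟨?_, (e1 h.1).trans h.2⟩
          rintro rfl
          rw [zero_pow hc0] at h
          exact zero_ne_one h.1
        · refine ⟨?_, (e2 h.1).trans (neg_eq_zero.2 h.2)⟩
          rintro rfl
          rw [zero_pow hc0] at h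
          exact neg_ne_zero.2 one_ne_zero h.1.symm
    · rw [Finset.disjoint_left]
      intro x hx hx'
      simp only [Finset.mem_filter, Finset.mem_univ, true_and] at hx hx'
      exact neg_one_ne17 F (hx'.1.symm.trans hx.1)
  rw [h4] at h3
  push_cast at h1 h2
  omega

lemma param17 (p : F) (hp : orderOf p = Fintype.card F - 1) (Q : F → Prop) [DecidablePred Q] :
    ((Finset.range (Fintype.card F - 1)).filter fun i => Q (p⁻¹ ^ i)).card =
      ((Finset.univ.erase (0 : F)).filter Q).card := by
  have h1 : 1 < Fintype.card F := Fintype.one_lt_card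
  have hp0 : p ≠ 0 := by
    rintro rfl
    rw [orderOf_zero] at hp
    omega
  have hinv : orderOf p⁻¹ = Fintype.card F - 1 := by
    rw [← hp]
    apply Nat.dvd_antisymm
    · rw [orderOf_dvd_iff_pow_eq_one, inv_pow, pow_orderOf_eq_one, inv_one]
    · rw [orderOf_dvd_iff_pow_eq_one, ← inv_inj, ← inv_pow, pow_orderOf_eq_one, inv_one]
  have hinj : Set.InjOn (fun i => p⁻¹ ^ i) (Finset.range (Fintype.card F - 1) : Set ℕ) := by
    intro i hi j hj hij
    rw [Finset.coe_range, ← hinv] at hi hj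
    exact pow_injOn_Iio_orderOf hi hj hij
  have him : (Finset.range (Fintype.card F - 1)).image (fun i => p⁻¹ ^ i) = Finset.univ.erase 0 := by
    apply Finset.eq_of_subset_of_card_le
    · intro x hx
      obtain ⟨i, _, rfl⟩ := Finset.mem_image.1 hx
      simp [hp0]
    · rw [Finset.card_image_of_injOn hinj, Finset.card_range,
        Finset.card_erase_of_mem (Finset.mem_univ _), Finset.card_univ]
  rw [← him, Finset.filter_image, Finset.card_image_of_injOn]
  intro i hi j hj
  simp only [Finset.coe_filter, Set.mem_ofPred_eq] at hi hj
  exact hinj hi.1 hj.1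

lemma main17 (ℓ : ℕ) (hℓ : 1 ≤ ℓ) (m u v : ℕ)
    (hm : m = 2 * ℓ + 1) (hu : u = (3 ^ m + 1) / 2) (hv : v = 2 * 3 ^ ℓ + 1)
    (hq : Fintype.card F = 3 ^ m)
    (p : F) (hp : orderOf p = 3 ^ m - 1)
    (a b : F) (hab : ¬ (a = 0 ∧ b = 0)) (WT : ℕ)
    (hWT : WT = ((Finset.range (3 ^ m - 1)).filter (fun i =>
        Algebra.trace (ZMod 3) F (a * p⁻¹ ^ (u * i) + b * p⁻¹ ^ (v * i)) ≠ 0)).card) :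
    WT ∈ ({2 * 3 ^ (m - 1), 2 * 3 ^ (m - 1) + 2 * 3 ^ ℓ, 2 * 3 ^ (m - 1) - 2 * 3 ^ ℓ,
        2 * 3 ^ (m - 1) + 3 ^ ℓ, 2 * 3 ^ (m - 1) - 3 ^ ℓ} : Set ℕ) := by
  have hvo : Odd v := by rw [hv]; exact ⟨_, rfl⟩
  have hc : ∃ c, Odd c ∧ 3 ^ m = 2 * c + 1 := by
    obtain ⟨k, hk⟩ : Odd (3 ^ ℓ) := Odd.pow (by decide)
    refine ⟨2 * (3 * k ^ 2 + 3 * k) + 1, ⟨_, rfl⟩, ?_⟩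
    have : 3 ^ (2 * ℓ + 1) = 3 * (3 ^ ℓ * 3 ^ ℓ) := by ring
    rw [hm, this, hk]
    ring
  obtain ⟨c, hco, hc⟩ := hc
  have huc : u = c + 1 := by omega
  have hW : WT = ((Finset.univ.erase (0 : F)).filter fun x =>
      tr17 (a * x ^ (c + 1) + b * x ^ v) ≠ 0).card := by
    rw [hWT, ← param17 p (by rw [hq, hp]), hq]
    congr 1
    apply Finset.filter_congr
    intro i _
    rw [← pow_mul, ← pow_mul, mul_comm i, mul_comm i, huc]
  have hw := weight17 c v hco hvo (hq.trans hc) a b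
  rw [← hW, hq] at hw
  have hS : ∀ b' : F, (b' = b ∨ b' = -b) → (S17 v a b' = 0 ∨ S17 v a b' = 3 ^ (ℓ + 1) ∨
      S17 v a b' = -3 ^ (ℓ + 1)) := by
    intro b' hb'
    by_cases hb : b = 0
    · have : b' = 0 := by rcases hb' with h | h <;> simp [h, hb]
      subst this
      left
      exact S_b0_17 v hvo a (fun h => hab ⟨h, hb⟩)
    · have : b' ≠ 0 := by rcases hb' with h | h <;> simp [h, hb]
      rw [hv]
      exact S_three17 ℓ hℓ (by rw [hq, hm]) a b' this
  have e1 : (3 : ℕ) ^ m = 3 * 3 ^ (m - 1) := by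
    rw [← pow_succ']; congr 1; omega
  have e2 : (3 : ℤ) ^ (ℓ + 1) = 3 * ((3 ^ ℓ : ℕ) : ℤ) := by push_cast; ring
  have e3 : (3 : ℕ) ^ ℓ ≤ 3 ^ (m - 1) := Nat.pow_le_pow_right (by norm_num) (by omega)
  rw [e1] at hw
  have s1 := hS b (Or.inl rfl)
  have s2 := hS (-b) (Or.inr rfl)
  rw [e2] at s1 s2
  simp only [Set.mem_insert_iff, Set.mem_singleton_iff]
  push_cast at hw
  generalize (3 : ℕ) ^ ℓ = X at *
  have e4 : ((3 : ℤ) ^ (m - 1)) = ((3 ^ (m - 1) : ℕ) : ℤ) := by push_cast; rfl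
  rw [e4] at hw
  generalize (3 : ℕ) ^ (m - 1) = Y at *
  rcases s1 with s1 | s1 | s1 <;> rcases s2 with s2 | s2 | s2 <;> rw [s1, s2] at hw <;> omega

end Weights17

theorem stmt_17 (ℓ : ℕ) (hℓ : 1 ≤ ℓ) (m u v : ℕ)
    (hm : m = 2 * ℓ + 1) (hu : u = (3 ^ m + 1) / 2) (hv : v = 2 * 3 ^ ℓ + 1)
    (π : GaloisField 3 m) (hπ : orderOf π = 3 ^ m - 1)
    (a b : GaloisField 3 m) (hab : ¬ (a = 0 ∧ b = 0)) (WT : ℕ)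
    (hWT : WT = ((Finset.range (3 ^ m - 1)).filter (fun i =>
        Algebra.trace (ZMod 3) (GaloisField 3 m)
          (a * π⁻¹ ^ (u * i) + b * π⁻¹ ^ (v * i)) ≠ 0)).card) :
    WT ∈ ({2 * 3 ^ (m - 1), 2 * 3 ^ (m - 1) + 2 * 3 ^ ℓ, 2 * 3 ^ (m - 1) - 2 * 3 ^ ℓ,
        2 * 3 ^ (m - 1) + 3 ^ ℓ, 2 * 3 ^ (m - 1) - 3 ^ ℓ} : Set ℕ) := by
  classical
  have : Fintype (GaloisField 3 m) := Fintype.ofFinite _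
  have hq : Fintype.card (GaloisField 3 m) = 3 ^ m := by
    rw [← Nat.card_eq_fintype_card]
    exact GaloisField.card 3 m (by omega)
  exact main17 ℓ hℓ m u v hm hu hv hq π hπ a b hab WT hWT
end
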